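/- arXiv:1508.06250 — 2 statements merged into one kernel-verified Lean document; each statement's English description precedes it below -/
import Mathlib

section
/- Let f, g be holomorphic functions defined on neighborhoods of 0 ∈ ℂⁿ with f(0) = g(0) = 0, and set X = V(f), Y = V(g). If there exists a bi-Lipschitz homeomorphism φ : (ℂⁿ, X, 0) → (ℂⁿ, Y, 0), then there exists a bi-Lipschitz homeomorphism ψ : ℂⁿ → ℂⁿ with ψ(0) = 0 mapping the tangent cone C(X) of X at 0 onto the tangent cone C(Y) of Y at 0. (Bi-Lipschitz invariance of tangent cones, for analytic hypersurface germs.) -/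
open scoped Topology

noncomputable section

/-- `ℂⁿ` with the Euclidean metric. -/
abbrev En (n : ℕ) := EuclideanSpace ℂ (Fin n)

/-- A bi-Lipschitz homeomorphism of germs `φ : (ℂⁿ, X, 0) → (ℂⁿ, Y, 0)`. -/
def BiLipGermHomeo {n : ℕ} (X Y : Set (En n)) : Prop :=
  ∃ (U U' : Set (En n)) (φ ψ : En n → En n) (K : NNReal),
    IsOpen U ∧ IsOpen U' ∧ (0 : En n) ∈ U ∧ (0 : En n) ∈ U' ∧
    φ 0 = 0 ∧
    Set.MapsTo φ U U' ∧ Set.MapsTo ψ U' U ∧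
    Set.LeftInvOn ψ φ U ∧ Set.RightInvOn ψ φ U' ∧
    LipschitzOnWith K φ U ∧ LipschitzOnWith K ψ U' ∧
    φ '' (X ∩ U) = Y ∩ U'

open Filter in
theorem aux_leading {n : ℕ} {f : En n → ℂ} (hf : AnalyticAt ℂ f 0) :
    (∀ᶠ x in 𝓝 (0 : En n), f x = 0) ∨ ∃ (m : ℕ) (P : En n → ℂ), Differentiable ℂ P ∧
      (∀ (c : ℂ) (x : En n), P (c • x) = c ^ m * P x) ∧ (∃ w, P w ≠ 0) ∧
      (fun y => f y - P y) =O[𝓝 0] fun y => ‖y‖ ^ (m + 1) := by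
  classical
  obtain ⟨p, hp⟩ := hf
  by_cases h : ∃ k, ∃ x : En n, p k (fun _ => x) ≠ 0
  · right
    refine ⟨Nat.find h, fun x => p (Nat.find h) (fun _ => x), ?_, ?_, Nat.find_spec h, ?_⟩
    · intro x
      have h1 : DifferentiableAt ℂ (fun y : Fin (Nat.find h) → En n => p (Nat.find h) y)
          (fun _ => x) := ((p (Nat.find h)).hasFDerivAt (fun _ => x)).differentiableAt
      have h2 : DifferentiableAt ℂ (fun x : En n => (fun _ : Fin (Nat.find h) => x)) x := by
        fun_prop
      exact DifferentiableAt.comp x h1 h2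
    · intro c x
      have := (p (Nat.find h)).map_smul_univ (fun _ => c) (fun _ => x)
      simpa using this
    · have h1 := hp.isBigO_sub_partialSum_pow (Nat.find h + 1)
      refine h1.congr_left fun y => ?_
      rw [FormalMultilinearSeries.partialSum, Finset.sum_range_succ, Finset.sum_eq_zero]
      · simp
      · intro i hi
        have := Nat.find_min h (Finset.mem_range.1 hi)
        push Not at this
        exact this y
  · left
    push Not at h
    filter_upwards [hp.eventually_hasSum] with x hx
    have : (fun n : ℕ => p n fun _ : Fin n => x) = fun _ => 0 := by
      funext k; exact h k x
    rw [this, zero_add] at hx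
    exact hx.unique hasSum_zero

open Filter in
theorem aux_cone_zero {n : ℕ} {f P : En n → ℂ} {m : ℕ} {W : Set (En n)} (hP : Continuous P)
    (hhom : ∀ (c : ℂ) (x : En n), P (c • x) = c ^ m * P x)
    (hO : (fun y => f y - P y) =O[𝓝 0] fun y => ‖y‖ ^ (m + 1)) {v : En n}
    (hv : v ∈ tangentConeAt ℝ {x ∈ W | f x = 0} 0) : P v = 0 := by
  obtain ⟨c, d, hd, hds, hcd⟩ := mem_tangentConeAt_iff_exists_seq.1 hv
  obtain ⟨C, hC⟩ := hO.bound
  have h1 : Tendsto (fun k => P (c k • d k)) atTop (𝓝 (P v)) := (hP.tendsto v).comp hcd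
  refine tendsto_nhds_unique h1 ?_
  have h2 : Tendsto (fun k => C * ‖c k • d k‖ ^ m * ‖d k‖) atTop (𝓝 0) := by
    have := ((hcd.norm.pow m).const_mul C).mul hd.norm
    simpa using this
  refine squeeze_zero_norm' ?_ h2
  filter_upwards [hds, hd.eventually hC] with k hk hk2
  have hk3 : f (d k) = 0 := by simpa using hk.2
  have e : c k • d k = (c k : ℂ) • d k := by simp
  rw [hk3, zero_sub, norm_neg, norm_pow, norm_norm] at hk2
  rw [e, hhom, norm_mul, norm_pow, norm_smul, mul_pow]
  calc _ ≤ ‖(c k : ℂ)‖ ^ m * (C * ‖d k‖ ^ (m + 1)) := by gcongr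
    _ = _ := by ring

open Filter in
theorem aux_near {n : ℕ} {f P : En n → ℂ} {m : ℕ} {W : Set (En n)} (hW : IsOpen W)
    (hW0 : (0 : En n) ∈ W) (hf : AnalyticOnNhd ℂ f W) (hP : Differentiable ℂ P)
    (hhom : ∀ (c : ℂ) (x : En n), P (c • x) = c ^ m * P x) (hne : ∃ w, P w ≠ 0)
    (hO : (fun y => f y - P y) =O[𝓝 0] fun y => ‖y‖ ^ (m + 1)) {v : En n} (hv : P v = 0)
    {ε : ℝ} (hε : 0 < ε) :
    ∀ᶠ k : ℕ in atTop, ∃ x ∈ {x ∈ W | f x = 0}, ‖(k : ℝ) • x - v‖ < ε := by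
  obtain ⟨w, hw⟩ := hne
  set q : ℂ → ℂ := fun z => P (v + z • w) with hq
  have hqd : Differentiable ℂ q := by
    intro z
    exact DifferentiableAt.comp z (hP _) (by fun_prop)
  -- q not identically zero
  have hq0 : ¬ ∀ z, q z = 0 := by
    intro hz
    have h1 : Tendsto (fun s : ℂ => P (w + s • v)) (𝓝[≠] 0) (𝓝 (P w)) := by
      have : Continuous (fun s : ℂ => P (w + s • v)) := hP.continuous.comp (by fun_prop)
      have := this.tendsto 0
      simp only [zero_smul, add_zero] at this
      exact this.mono_left nhdsWithin_le_nhds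
    have h2 : Tendsto (fun s : ℂ => P (w + s • v)) (𝓝[≠] 0) (𝓝 0) := by
      refine tendsto_const_nhds.congr' ?_
      filter_upwards [self_mem_nhdsWithin] with s hs
      have hs' : s ≠ 0 := hs
      have : w + s • v = s • (v + s⁻¹ • w) := by
        rw [smul_add, smul_inv_smul₀ hs', add_comm]
      rw [this, hhom]
      have := hz s⁻¹
      simp only [hq] at this
      rw [this, mul_zero]
    exact hw (tendsto_nhds_unique h1 h2)
  have hqa : AnalyticOnNhd ℂ q Set.univ := fun z _ => hqd.analyticAt z
  have hev : ∀ᶠ z in 𝓝[≠] (0 : ℂ), q z ≠ 0 := by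
    rcases (hqd.analyticAt 0).eventually_eq_zero_or_eventually_ne_zero with h | h
    · exfalso
      apply hq0
      intro z
      exact hqa.eqOn_zero_of_preconnected_of_eventuallyEq_zero isPreconnected_univ
        (Set.mem_univ 0) h (Set.mem_univ z)
    · exact h
  rw [eventually_nhdsWithin_iff, Metric.eventually_nhds_iff] at hev
  obtain ⟨r0, hr0, hr0'⟩ := hev
  obtain ⟨r, hr, hrr0, hrε⟩ : ∃ r : ℝ, 0 < r ∧ r < r0 ∧ r * ‖w‖ < ε := by
    refine ⟨min (r0 / 2) (ε / (2 * (‖w‖ + 1))), by positivity, ?_, ?_⟩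
    · exact (min_le_left _ _).trans_lt (by linarith)
    · calc _ ≤ ε / (2 * (‖w‖ + 1)) * ‖w‖ := by gcongr; exact min_le_right _ _
        _ < ε := by
          rw [div_mul_eq_mul_div, div_lt_iff₀ (by positivity)]
          nlinarith [norm_nonneg w]
  have hsph : ∀ z ∈ Metric.sphere (0 : ℂ) r, 0 < ‖q z‖ := by
    intro z hz
    have hz' : ‖z‖ = r := by simpa using hz
    refine norm_pos_iff.2 (hr0' (by simpa [hz'] using hrr0) ?_)
    rintro rfl
    simp at hz'
    linarith
  obtain ⟨z0, hz0, hmin⟩ := (isCompact_sphere (0 : ℂ) r).exists_isMinOn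
    (NormedSpace.sphere_nonempty.2 hr.le) (hqd.continuous.norm.continuousOn)
  set μ := ‖q z0‖ with hμ
  have hμ0 : 0 < μ := hsph z0 hz0
  obtain ⟨C, hC0, hC⟩ := hO.exists_pos
  have hC := hC.bound
  obtain ⟨δ, hδ, hδ'⟩ := Metric.eventually_nhds_iff.1 (hC.and (hW.mem_nhds hW0))
  set R := ‖v‖ + r * ‖w‖ with hR
  have hR0 : 0 ≤ R := by positivity
  have l1 : ∀ᶠ k : ℕ in atTop, R / (k : ℝ) < δ :=
    (tendsto_const_div_atTop_nhds_zero_nat R).eventually_lt_const hδ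
  have l2 : ∀ᶠ k : ℕ in atTop, C * R ^ (m + 1) / (k : ℝ) < μ / 2 :=
    (tendsto_const_div_atTop_nhds_zero_nat _).eventually_lt_const (by positivity)
  filter_upwards [l1, l2, eventually_gt_atTop 0] with k k1 k2 k0
  have k0' : (0 : ℝ) < k := by exact_mod_cast k0
  have kC : (k : ℂ) ≠ 0 := by exact_mod_cast k0.ne'
  set y : ℂ → En n := fun z => (k : ℂ)⁻¹ • (v + z • w) with hy
  have hyn : ∀ z, ‖z‖ ≤ r → ‖y z‖ ≤ R / k := by
    intro z hz
    simp only [hy, norm_smul, norm_inv, Complex.norm_natCast]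
    rw [inv_mul_eq_div]
    gcongr
    refine (norm_add_le _ _).trans ?_
    rw [norm_smul, hR]
    gcongr
  have hyW : ∀ z, ‖z‖ ≤ r → y z ∈ W := fun z hz =>
    (hδ' (by simpa using (hyn z hz).trans_lt k1)).2
  have hclose : ∀ z, ‖z‖ ≤ r → ‖(k : ℂ) ^ m * f (y z) - q z‖ ≤ C * R ^ (m + 1) / k := by
    intro z hz
    have h1 := (hδ' (show dist (y z) 0 < δ by simpa using (hyn z hz).trans_lt k1)).1
    have h2 : q z = (k : ℂ) ^ m * P (y z) := by
      rw [← hhom, hy]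
      simp only [hq]
      rw [smul_inv_smul₀ kC]
    rw [h2, ← mul_sub, norm_mul, norm_pow, Complex.norm_natCast]
    rw [norm_pow, norm_norm] at h1
    calc _ ≤ (k : ℝ) ^ m * (C * (R / k) ^ (m + 1)) := by
          gcongr
          refine h1.trans ?_
          gcongr
          exact hyn z hz
      _ = _ := by rw [div_pow]; field_simp; ring
  suffices ∃ z : ℂ, ‖z‖ ≤ r ∧ f (y z) = 0 by
    obtain ⟨z, hz, hz0⟩ := this
    refine ⟨y z, ⟨hyW z hz, hz0⟩, ?_⟩
    have e : (k : ℝ) • y z = (k : ℂ) • y z := by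
      rw [← Complex.coe_smul]; simp
    rw [e, hy]
    simp only
    rw [smul_inv_smul₀ kC, add_sub_cancel_left, norm_smul]
    calc _ ≤ r * ‖w‖ := by gcongr
      _ < ε := hrε
  by_contra! hno
  set G : ℂ → ℂ := fun z => (k : ℂ) ^ m * f (y z) with hG
  have hGne : ∀ z, ‖z‖ ≤ r → G z ≠ 0 := fun z hz =>
    mul_ne_zero (pow_ne_zero _ kC) (hno z hz)
  have hGd : ∀ z, ‖z‖ ≤ r → DifferentiableAt ℂ G z := by
    intro z hz
    have : DifferentiableAt ℂ (fun z => f (y z)) z :=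
      DifferentiableAt.comp z (hf _ (hyW z hz)).differentiableAt (by simp only [hy]; fun_prop)
    exact this.const_mul _
  have hdc : DiffContOnCl ℂ (fun z => (G z)⁻¹) (Metric.ball 0 r) := by
    apply DifferentiableOn.diffContOnCl
    rw [closure_ball _ hr.ne']
    intro z hz
    have hz' : ‖z‖ ≤ r := by simpa using hz
    exact ((hGd z hz').inv (hGne z hz')).differentiableWithinAt
  have hmax := Complex.norm_le_of_forall_mem_frontier_norm_le Metric.isBounded_ball hdc
    (C := (μ / 2)⁻¹) (z := 0) ?_ (subset_closure (by simpa using hr))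
  · have h0 := hclose 0 (by simpa using hr.le)
    have hq00 : q 0 = 0 := by simp [hq, hv]
    rw [hq00, sub_zero] at h0
    have hG0 : 0 < ‖G 0‖ := norm_pos_iff.2 (hGne 0 (by simpa using hr.le))
    rw [norm_inv, inv_le_inv₀ hG0 (by positivity)] at hmax
    have : ‖G 0‖ ≤ C * R ^ (m + 1) / k := h0
    linarith
  · intro z hz
    rw [frontier_ball _ hr.ne'] at hz
    have hz' : ‖z‖ = r := by simpa using hz
    have h0 := hclose z hz'.le
    have hm : μ ≤ ‖q z‖ := hmin hz
    have : ‖q z‖ ≤ ‖G z‖ + ‖G z - q z‖ := by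
      have := norm_sub_le (G z) (G z - q z)
      simpa using this
    have h0' : ‖G z - q z‖ ≤ C * R ^ (m + 1) / k := h0
    rw [norm_inv]
    exact inv_anti₀ (by positivity) (by linarith)

open Filter in
theorem aux_seq {n : ℕ} {f : En n → ℂ} {W : Set (En n)} (hW : IsOpen W)
    (hW0 : (0 : En n) ∈ W) (hf : AnalyticOnNhd ℂ f W) (hf0 : f 0 = 0) {v : En n}
    (hv : v ∈ tangentConeAt ℝ {x ∈ W | f x = 0} 0) :
    ∃ x : ℕ → En n, (∀ k, x k ∈ {x ∈ W | f x = 0}) ∧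
      Tendsto (fun k : ℕ => (k : ℝ) • x k) atTop (𝓝 v) := by
  have key : ∀ ε > 0, ∀ᶠ k : ℕ in atTop,
      ∃ x ∈ {x ∈ W | f x = 0}, ‖(k : ℝ) • x - v‖ < ε := by
    intro ε hε
    rcases aux_leading (hf 0 hW0) with h | ⟨m, P, hP, hhom, hne, hO⟩
    · have t : Tendsto (fun k : ℕ => (k : ℝ)⁻¹ • v) atTop (𝓝 0) := by
        simpa using (tendsto_inv_atTop_nhds_zero_nat (𝕜 := ℝ)).smul_const v
      filter_upwards [t.eventually h, t.eventually (hW.mem_nhds hW0), eventually_gt_atTop 0]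
        with k h1 h2 h3
      have : (k : ℝ) ≠ 0 := by exact_mod_cast h3.ne'
      exact ⟨_, ⟨h2, h1⟩, by rw [smul_inv_smul₀ this]; simpa using hε⟩
    · exact aux_near hW hW0 hf hP hhom hne hO (aux_cone_zero hP.continuous hhom hO hv) hε
  have hne : ∀ k : ℕ, ((fun x : En n => (k : ℝ) • x) '' {x ∈ W | f x = 0}).Nonempty :=
    fun k => ⟨_, 0, ⟨hW0, hf0⟩, rfl⟩
  have hch : ∀ k : ℕ, ∃ x ∈ {x ∈ W | f x = 0}, dist v ((k : ℝ) • x) <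
      Metric.infDist v ((fun x : En n => (k : ℝ) • x) '' {x ∈ W | f x = 0}) + 1 / ((k : ℝ) + 1) := by
    intro k
    have hp : (0 : ℝ) < 1 / ((k : ℝ) + 1) := by positivity
    obtain ⟨_, ⟨x, hx, rfl⟩, h⟩ := (Metric.infDist_lt_iff (hne k)).1 (lt_add_of_pos_right
      (Metric.infDist v ((fun x : En n => (k : ℝ) • x) '' {x ∈ W | f x = 0})) hp)
    exact ⟨x, hx, h⟩
  choose x hx hxd using hch
  refine ⟨x, hx, ?_⟩
  rw [Metric.tendsto_nhds]
  intro ε hε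
  have t := (tendsto_one_div_add_atTop_nhds_zero_nat (𝕜 := ℝ)).eventually_lt_const (half_pos hε)
  filter_upwards [key (ε / 2) (half_pos hε), t] with k ⟨x', hx', h1⟩ h2
  have h3 : Metric.infDist v ((fun x : En n => (k : ℝ) • x) '' {x ∈ W | f x = 0}) ≤
      dist v ((k : ℝ) • x') := Metric.infDist_le_dist_of_mem ⟨x', hx', rfl⟩
  have h4 : dist v ((k : ℝ) • x') < ε / 2 := by rw [dist_comm, dist_eq_norm]; exact h1
  have := hxd k
  rw [dist_comm]
  linarith

open Filter in
theorem aux_to_zero {n : ℕ} {l : Filter ℕ} (hl : l ≤ atTop) {x : ℕ → En n} {v : En n}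
    (h : Tendsto (fun k : ℕ => (k : ℝ) • x k) l (𝓝 v)) : Tendsto x l (𝓝 0) := by
  refine tangentConeAt.lim_zero (𝕜 := ℝ) l (c := fun k : ℕ => (k : ℝ)) ?_ h
  simpa using (tendsto_natCast_atTop_atTop (R := ℝ)).mono_left hl

open Filter in
theorem aux_blow {n : ℕ} {φ : En n → En n} {U : Set (En n)} {K : NNReal} (hU : IsOpen U)
    (h0 : (0 : En n) ∈ U) (hφ0 : φ 0 = 0) (hL : LipschitzOnWith K φ U) :
    ∃ Ψ : En n → En n, LipschitzWith K Ψ ∧ ∀ (v : En n) (x : ℕ → En n),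
      Tendsto (fun k : ℕ => (k : ℝ) • x k) (hyperfilter ℕ : Filter ℕ) (𝓝 v) →
      Tendsto (fun k : ℕ => (k : ℝ) • φ (x k)) (hyperfilter ℕ : Filter ℕ) (𝓝 (Ψ v)) := by
  have hle : (hyperfilter ℕ : Filter ℕ) ≤ atTop := Nat.hyperfilter_le_atTop
  have hpos : ∀ᶠ k : ℕ in (hyperfilter ℕ : Filter ℕ), 0 < k := hle (eventually_gt_atTop 0)
  have base : ∀ v : En n, Tendsto (fun k : ℕ => (k : ℝ) • ((k : ℝ)⁻¹ • v))
      (hyperfilter ℕ : Filter ℕ) (𝓝 v) := by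
    intro v
    refine tendsto_const_nhds.congr' ?_
    filter_upwards [hpos] with k hk
    have : (k : ℝ) ≠ 0 := by exact_mod_cast hk.ne'
    rw [smul_inv_smul₀ this]
  have inU : ∀ (v : En n) (x : ℕ → En n),
      Tendsto (fun k : ℕ => (k : ℝ) • x k) (hyperfilter ℕ : Filter ℕ) (𝓝 v) →
      ∀ᶠ k in (hyperfilter ℕ : Filter ℕ), x k ∈ U := fun v x h =>
    (aux_to_zero hle h).eventually (hU.mem_nhds h0)
  have scale : ∀ (k : ℕ) (a b : En n), a ∈ U → b ∈ U →
      dist ((k : ℝ) • φ a) ((k : ℝ) • φ b) ≤ K * dist ((k : ℝ) • a) ((k : ℝ) • b) := by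
    intro k a b ha hb
    rw [dist_smul₀, dist_smul₀]
    have := hL.dist_le_mul a ha b hb
    calc _ ≤ ‖(k : ℝ)‖ * (K * dist a b) := by gcongr
      _ = _ := by ring
  have ex : ∀ v : En n, ∃ y, Tendsto (fun k : ℕ => (k : ℝ) • φ ((k : ℝ)⁻¹ • v))
      (hyperfilter ℕ : Filter ℕ) (𝓝 y) := by
    intro v
    have hc := isCompact_closedBall (0 : En n) (K * ‖v‖)
    have := hc.ultrafilter_le_nhds
      ((hyperfilter ℕ).map (fun k : ℕ => (k : ℝ) • φ ((k : ℝ)⁻¹ • v))) ?_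
    · obtain ⟨y, -, hy⟩ := this
      exact ⟨y, hy⟩
    · rw [le_principal_iff]
      change ∀ᶠ k : ℕ in (hyperfilter ℕ : Filter ℕ),
        (k : ℝ) • φ ((k : ℝ)⁻¹ • v) ∈ Metric.closedBall (0 : En n) (K * ‖v‖)
      filter_upwards [inU v _ (base v), hpos] with k hk hk0
      have hk' : (k : ℝ) ≠ 0 := by exact_mod_cast hk0.ne'
      have := scale k _ 0 hk h0
      rw [hφ0, smul_zero, smul_inv_smul₀ hk', dist_zero_right v] at this
      exact this
  choose Ψ hΨ using ex
  refine ⟨Ψ, ?_, ?_⟩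
  · refine LipschitzWith.of_dist_le_mul fun v w => ?_
    refine le_of_tendsto ((hΨ v).dist (hΨ w)) ?_
    filter_upwards [inU v _ (base v), inU w _ (base w), hpos] with k h1 h2 hk0
    have hk' : (k : ℝ) ≠ 0 := by exact_mod_cast hk0.ne'
    have := scale k _ _ h1 h2
    rwa [smul_inv_smul₀ hk', smul_inv_smul₀ hk'] at this
  · intro v x hx
    refine (hΨ v).congr_dist ?_
    have hz : Tendsto (fun k : ℕ => (K : ℝ) * dist ((k : ℝ) • ((k : ℝ)⁻¹ • v)) ((k : ℝ) • x k))
        (hyperfilter ℕ : Filter ℕ) (𝓝 0) := by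
      simpa using ((base v).dist hx).const_mul (K : ℝ)
    refine squeeze_zero' (Eventually.of_forall fun _ => dist_nonneg) ?_ hz
    filter_upwards [inU v _ (base v), inU v x hx] with k h1 h2
    exact scale k _ _ h1 h2

open Filter in
theorem aux_maps {n : ℕ} {f : En n → ℂ} {W : Set (En n)} (hW : IsOpen W)
    (hW0 : (0 : En n) ∈ W) (hf : AnalyticOnNhd ℂ f W) (hf0 : f 0 = 0) {U Y : Set (En n)}
    (hU : IsOpen U) (h0 : (0 : En n) ∈ U) {φ Ψ : En n → En n}
    (hY : ∀ x ∈ {x ∈ W | f x = 0} ∩ U, φ x ∈ Y)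
    (hΨ : ∀ (v : En n) (x : ℕ → En n),
      Tendsto (fun k : ℕ => (k : ℝ) • x k) (hyperfilter ℕ : Filter ℕ) (𝓝 v) →
      Tendsto (fun k : ℕ => (k : ℝ) • φ (x k)) (hyperfilter ℕ : Filter ℕ) (𝓝 (Ψ v)))
    {v : En n} (hv : v ∈ tangentConeAt ℝ {x ∈ W | f x = 0} 0) :
    Ψ v ∈ tangentConeAt ℝ Y 0 := by
  have hle : (hyperfilter ℕ : Filter ℕ) ≤ atTop := Nat.hyperfilter_le_atTop
  obtain ⟨x, hx, hxv⟩ := aux_seq hW hW0 hf hf0 hv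
  have hxv' := hxv.mono_left hle
  have ht := hΨ v x hxv'
  refine mem_tangentConeAt_of_seq (hyperfilter ℕ : Filter ℕ) (fun k : ℕ => (k : ℝ))
    (fun k => φ (x k)) (aux_to_zero hle ht) ?_ ht
  filter_upwards [(aux_to_zero hle hxv').eventually (hU.mem_nhds h0)] with k hk
  rw [zero_add]
  exact hY _ ⟨hx k, hk⟩

open Filter in
theorem aux_inv {n : ℕ} {U : Set (En n)} (hU : IsOpen U) (h0 : (0 : En n) ∈ U)
    {φ ψ Ψ Ψ' : En n → En n} (hinv : Set.LeftInvOn ψ φ U)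
    (hΨ : ∀ (v : En n) (x : ℕ → En n),
      Tendsto (fun k : ℕ => (k : ℝ) • x k) (hyperfilter ℕ : Filter ℕ) (𝓝 v) →
      Tendsto (fun k : ℕ => (k : ℝ) • φ (x k)) (hyperfilter ℕ : Filter ℕ) (𝓝 (Ψ v)))
    (hΨ' : ∀ (v : En n) (x : ℕ → En n),
      Tendsto (fun k : ℕ => (k : ℝ) • x k) (hyperfilter ℕ : Filter ℕ) (𝓝 v) →
      Tendsto (fun k : ℕ => (k : ℝ) • ψ (x k)) (hyperfilter ℕ : Filter ℕ) (𝓝 (Ψ' v)))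
    (v : En n) : Ψ' (Ψ v) = v := by
  have hle : (hyperfilter ℕ : Filter ℕ) ≤ atTop := Nat.hyperfilter_le_atTop
  have hpos : ∀ᶠ k : ℕ in (hyperfilter ℕ : Filter ℕ), 0 < k := hle (eventually_gt_atTop 0)
  have base : Tendsto (fun k : ℕ => (k : ℝ) • ((k : ℝ)⁻¹ • v))
      (hyperfilter ℕ : Filter ℕ) (𝓝 v) := by
    refine tendsto_const_nhds.congr' ?_
    filter_upwards [hpos] with k hk
    have : (k : ℝ) ≠ 0 := by exact_mod_cast hk.ne'
    rw [smul_inv_smul₀ this]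
  refine tendsto_nhds_unique (hΨ' _ _ (hΨ v _ base)) (base.congr' ?_)
  filter_upwards [(aux_to_zero hle base).eventually (hU.mem_nhds h0)] with k hk
  rw [hinv hk]

/-- Theorem (bi-Lipschitz invariance of tangent cones for analytic hypersurface germs):
if `f, g` are holomorphic near `0 ∈ ℂⁿ`, vanish at `0`, and there is a bi-Lipschitz
homeomorphism of germs `(ℂⁿ, V(f), 0) → (ℂⁿ, V(g), 0)`, then there is a global
bi-Lipschitz homeomorphism `ψ : ℂⁿ → ℂⁿ` with `ψ 0 = 0` mapping the tangent cone
`C(V(f))` at `0` onto the tangent cone `C(V(g))` at `0`. -/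
theorem bilip_invariance_of_tangent_cones
    (n : ℕ) (f g : En n → ℂ) (W W' : Set (En n))
    (hWopen : IsOpen W) (hW0 : (0 : En n) ∈ W)
    (hW'open : IsOpen W') (hW'0 : (0 : En n) ∈ W')
    (hf : AnalyticOnNhd ℂ f W) (hg : AnalyticOnNhd ℂ g W')
    (hf0 : f 0 = 0) (hg0 : g 0 = 0)
    (hφ : BiLipGermHomeo {x ∈ W | f x = 0} {x ∈ W' | g x = 0}) :
    ∃ (ψ : En n ≃ En n) (K : NNReal),
      ψ 0 = 0 ∧ LipschitzWith K ψ ∧ LipschitzWith K ψ.symm ∧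
      ψ '' tangentConeAt ℝ {x ∈ W | f x = 0} 0 =
        tangentConeAt ℝ {x ∈ W' | g x = 0} 0 := by
  obtain ⟨U, U', φ, φ', K, hU, hU', h0, h0', hφ0, hm, hm', hl, hr, hL, hL', him⟩ := hφ
  have hφ'0 : φ' 0 = 0 := by
    have := hl h0
    rwa [hφ0] at this
  obtain ⟨Ψ, hΨL, hΨ⟩ := aux_blow hU h0 hφ0 hL
  obtain ⟨Ψ', hΨL', hΨ'⟩ := aux_blow hU' h0' hφ'0 hL'
  have i1 : ∀ v, Ψ' (Ψ v) = v := aux_inv hU h0 hl hΨ hΨ'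
  have i2 : ∀ v, Ψ (Ψ' v) = v := aux_inv hU' h0' hr hΨ' hΨ
  have m1 : ∀ v ∈ tangentConeAt ℝ {x ∈ W | f x = 0} 0,
      Ψ v ∈ tangentConeAt ℝ {x ∈ W' | g x = 0} 0 := fun v hv =>
    aux_maps hWopen hW0 hf hf0 hU h0
      (fun x hx => (him.subset (Set.mem_image_of_mem φ hx)).1) hΨ hv
  have m2 : ∀ v ∈ tangentConeAt ℝ {x ∈ W' | g x = 0} 0,
      Ψ' v ∈ tangentConeAt ℝ {x ∈ W | f x = 0} 0 := fun v hv =>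
    aux_maps hW'open hW'0 hg hg0 hU' h0'
      (fun y hy => by
        obtain ⟨x, hx, rfl⟩ := him.superset hy
        rw [hl hx.2]
        exact hx.1) hΨ' hv
  have z0 : Ψ 0 = 0 := by
    have h1 := hΨ 0 (fun _ => 0) (by simpa using tendsto_const_nhds)
    refine tendsto_nhds_unique h1 ?_
    simpa [hφ0] using tendsto_const_nhds
  refine ⟨⟨Ψ, Ψ', i1, i2⟩, K, z0, hΨL, hΨL', ?_⟩
  ext y
  constructor
  · rintro ⟨v, hv, rfl⟩
    exact m1 v hv
  · intro hy
    exact ⟨Ψ' y, m2 y hy, i2 y⟩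
end
end

section
/- Let f, g ∈ ℂ[z₁,…,zₙ] be nonconstant square-free homogeneous polynomials and let φ : U → U' be a bi-Lipschitz homeomorphism between open neighborhoods U, U' of 0 in ℂⁿ with φ(0) = 0 and φ(V(f) ∩ U) = V(g) ∩ U'. Then φ maps Sing V(f) ∩ U onto Sing V(g) ∩ U', where Sing V(p) = {x ∈ V(p) : all partial derivatives of p vanish at x}. (Bi-Lipschitz homeomorphisms between analytic sets send singular points to singular points and smooth points to smooth points.) -/
noncomputable section

/-- The zero set `V(p) ⊆ ℂⁿ` of a polynomial `p ∈ ℂ[z₁,…,zₙ]`. -/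
def pV {n : ℕ} (p : MvPolynomial (Fin n) ℂ) : Set (En n) :=
  {x | MvPolynomial.eval (x : Fin n → ℂ) p = 0}

/-- The singular set `Sing V(p) = {x ∈ V(p) : ∂p/∂z₁(x) = ⋯ = ∂p/∂zₙ(x) = 0}`. -/
def SingV {n : ℕ} (p : MvPolynomial (Fin n) ℂ) : Set (En n) :=
  {x | MvPolynomial.eval (x : Fin n → ℂ) p = 0 ∧
       ∀ i, MvPolynomial.eval (x : Fin n → ℂ) (MvPolynomial.pderiv i p) = 0}

noncomputable section
namespace Smith
open Finset

abbrev Ch (K : Type*) [Field K] (A : Type*) (n : ℕ) := (Fin n → A) →₀ K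

section chains
variable {K : Type*} [Field K] {A B : Type*}

def bd (n : ℕ) : Ch K A (n+1) →ₗ[K] Ch K A n :=
  Finsupp.linearCombination K
    (fun s => ∑ k : Fin (n+1), (-1:K)^(k:ℕ) • Finsupp.single (k.removeNth s) (1:K))

def cone (y : A) (n : ℕ) : Ch K A n →ₗ[K] Ch K A (n+1) :=
  Finsupp.lmapDomain K K (fun s => (Fin.cons y s : Fin (n+1) → A))

def mp (f : A → B) (n : ℕ) : Ch K A n →ₗ[K] Ch K B n :=
  Finsupp.lmapDomain K K (fun s => f ∘ s)

lemma bd_single (n : ℕ) (s : Fin (n+1) → A) : bd n (Finsupp.single s (1:K)) =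
    ∑ k : Fin (n+1), (-1:K)^(k:ℕ) • Finsupp.single (k.removeNth s) (1:K) := by
  simp [bd]

lemma cone_single (y : A) (n : ℕ) (s : Fin n → A) (a : K) :
    cone y n (Finsupp.single s a) = Finsupp.single (Fin.cons y s : Fin (n+1) → A) a := by
  simp [cone]

lemma mp_single (f : A → B) (n : ℕ) (s : Fin n → A) (a : K) :
    mp f n (Finsupp.single s a) = Finsupp.single (f ∘ s) a := by
  simp [mp]

lemma bd_cone (y : A) (n : ℕ) (z : Ch K A (n+1)) :
    bd (n+1) (cone y (n+1) z) = z - cone y n (bd n z) := by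
  suffices h : (bd (n+1)).comp (cone y (n+1)) = LinearMap.id - (cone y n).comp (bd n (K := K)) from
    LinearMap.congr_fun h z
  refine Finsupp.lhom_ext' fun s => LinearMap.ext_ring ?_
  simp only [LinearMap.comp_apply, Finsupp.lsingle_apply, LinearMap.sub_apply, LinearMap.id_apply,
    cone_single, bd_single, map_sum, map_smul]
  rw [Fin.sum_univ_succ]
  have : ∀ k : Fin (n+1), (Fin.removeNth k.succ (Fin.cons y s : Fin (n+2) → A)) =
      (Fin.cons y (k.removeNth s) : Fin (n+1) → A) := by
    intro k; ext i
    refine Fin.cases ?_ (fun i => ?_) i <;> simp [Fin.removeNth]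
  simp [this, pow_succ, Finset.sum_neg_distrib, sub_eq_add_neg]

lemma bd_cone0 (y : A) (z : Ch K A 0) :
    bd 0 (cone y 0 z) = z := by
  suffices h : (bd 0).comp (cone y 0) = LinearMap.id (R := K) from
    LinearMap.congr_fun h z
  refine Finsupp.lhom_ext' fun s => LinearMap.ext_ring ?_
  simp only [LinearMap.comp_apply, Finsupp.lsingle_apply, LinearMap.id_apply,
    cone_single, bd_single]
  simp

lemma bd_mp (f : A → B) (n : ℕ) (z : Ch K A (n+1)) :
    bd n (mp f (n+1) z) = mp f n (bd n z) := by
  suffices h : (bd n).comp (mp f (n+1)) = (mp f n).comp (bd n (K := K)) from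
    LinearMap.congr_fun h z
  refine Finsupp.lhom_ext' fun s => LinearMap.ext_ring ?_
  simp only [LinearMap.comp_apply, Finsupp.lsingle_apply,
    mp_single, bd_single, map_sum, map_smul]
  rfl

lemma single_eq_cone (n : ℕ) (s : Fin (n+1) → A) (a : K) :
    Finsupp.single s a = cone (s 0) n (Finsupp.single (Fin.tail s) a) := by
  rw [cone_single, Fin.cons_self_tail]

lemma bd_bd (n : ℕ) (z : Ch K A (n+2)) : bd n (bd (n+1) z) = 0 := by
  induction n with
  | zero =>
    suffices h : (bd 0).comp (bd 1) = (0 : Ch K A 2 →ₗ[K] _) from LinearMap.congr_fun h z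
    refine Finsupp.lhom_ext' fun s => LinearMap.ext_ring ?_
    simp only [LinearMap.comp_apply, Finsupp.lsingle_apply]
    rw [single_eq_cone, bd_cone, map_sub, bd_cone0, sub_self]; rfl
  | succ n ih =>
    suffices h : (bd (n+1)).comp (bd (n+2)) = (0 : Ch K A (n+3) →ₗ[K] _) from
      LinearMap.congr_fun h z
    refine Finsupp.lhom_ext' fun s => LinearMap.ext_ring ?_
    simp only [LinearMap.comp_apply, Finsupp.lsingle_apply]
    rw [single_eq_cone, bd_cone, map_sub, bd_cone, ih]; simp

def hmt (f g : A → B) : (n : ℕ) → (Ch K A n →ₗ[K] Ch K B (n+1))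
  | 0 => 0
  | n+1 => Finsupp.linearCombination K (fun s => cone (f (s 0)) (n+1)
      (mp g (n+1) (Finsupp.single s 1) - mp f (n+1) (Finsupp.single s 1)
        - hmt f g n (bd n (Finsupp.single s 1))))

lemma hmt_single (f g : A → B) (n : ℕ) (s : Fin (n+1) → A) :
    hmt f g (n+1) (Finsupp.single s (1:K)) = cone (f (s 0)) (n+1)
      (mp g (n+1) (Finsupp.single s 1) - mp f (n+1) (Finsupp.single s 1)
        - hmt f g n (bd n (Finsupp.single s 1))) := by
  rw [hmt]
  simp only [Finsupp.linearCombination_single, one_smul]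

lemma mp_zero_eq (f g : A → B) (z : Ch K A 0) : mp f 0 z = mp g 0 z := by
  unfold mp
  congr 2
  funext s; exact Subsingleton.elim _ _

lemma bd_hmt (f g : A → B) (n : ℕ) (z : Ch K A (n+1)) :
    bd (n+1) (hmt f g (n+1) z) = mp g (n+1) z - mp f (n+1) z - hmt f g n (bd n z) := by
  induction n with
  | zero =>
    suffices h : (bd 1).comp (hmt f g 1) = mp g 1 - mp f 1 - (hmt f g 0).comp (bd 0 (K := K)) from
      LinearMap.congr_fun h z
    refine Finsupp.lhom_ext' fun s => LinearMap.ext_ring ?_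
    simp only [LinearMap.comp_apply, Finsupp.lsingle_apply, LinearMap.sub_apply]
    rw [hmt_single, bd_cone]
    rw [hmt, LinearMap.zero_apply, sub_zero, map_sub, bd_mp, bd_mp,
      mp_zero_eq g f, sub_self, map_zero, sub_zero]
  | succ n ih =>
    suffices h : (bd (n+2)).comp (hmt f g (n+2)) =
        mp g (n+2) - mp f (n+2) - (hmt f g (n+1)).comp (bd (n+1) (K := K)) from
      LinearMap.congr_fun h z
    refine Finsupp.lhom_ext' fun s => LinearMap.ext_ring ?_
    simp only [LinearMap.comp_apply, Finsupp.lsingle_apply, LinearMap.sub_apply]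
    rw [hmt]
    simp only [Finsupp.linearCombination_single, one_smul]
    rw [bd_cone]
    simp only [map_sub, bd_mp, ih, bd_bd, map_zero]
    simp

lemma cone_supp (y : A) (n : ℕ) (z : Ch K A n) (S : Set (Fin n → A)) (S' : Set (Fin (n+1) → A))
    (h : ∀ s ∈ S, (Fin.cons y s : Fin (n+1) → A) ∈ S') (hz : z ∈ Finsupp.supported K K S) :
    cone y n z ∈ Finsupp.supported K K S' := by
  classical
  rw [Finsupp.mem_supported] at *
  intro t ht
  have := Finsupp.mapDomain_support (f := fun s => (Fin.cons y s : Fin (n+1) → A)) (s := z) ht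
  simp only [Finset.mem_image] at this
  obtain ⟨s, hs, rfl⟩ := this
  exact h s (hz hs)

lemma mp_supp (f : A → B) (n : ℕ) (z : Ch K A n) (S : Set (Fin n → A)) (S' : Set (Fin n → B))
    (h : ∀ s ∈ S, f ∘ s ∈ S') (hz : z ∈ Finsupp.supported K K S) :
    mp f n z ∈ Finsupp.supported K K S' := by
  classical
  rw [Finsupp.mem_supported] at *
  intro t ht
  have := Finsupp.mapDomain_support (f := fun s : Fin n → A => f ∘ s) (s := z) ht
  simp only [Finset.mem_image] at this
  obtain ⟨s, hs, rfl⟩ := this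
  exact h s (hz hs)

/-- extend a support statement from basis elements -/
lemma supp_ext {ι κ : Type*} (L : (ι →₀ K) →ₗ[K] (κ →₀ K)) (S : Set ι) (S' : Set κ)
    (h : ∀ s ∈ S, L (Finsupp.single s 1) ∈ Finsupp.supported K K S') (z : ι →₀ K)
    (hz : z ∈ Finsupp.supported K K S) : L z ∈ Finsupp.supported K K S' := by
  rw [← Finsupp.sum_single z, Finsupp.sum, map_sum]
  refine Submodule.sum_mem _ fun s hs => ?_
  have : Finsupp.single s (z s) = z s • Finsupp.single s (1:K) := by simp
  rw [this, map_smul]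
  exact Submodule.smul_mem _ _ (h s (hz hs))

lemma hmt_supp1 (f g : A → B) (n : ℕ) (s : Fin n → A) :
    hmt f g n (Finsupp.single s (1:K)) ∈ Finsupp.supported K K
      {t : Fin (n+1) → B | ∀ i, ∃ j, t i = f (s j) ∨ t i = g (s j)} := by
  induction n with
  | zero => simp [hmt]
  | succ n ih =>
    rw [hmt]
    simp only [Finsupp.linearCombination_single, one_smul]
    refine cone_supp _ _ _ {t | ∀ i, ∃ j, t i = f (s j) ∨ t i = g (s j)} _ ?_ ?_
    · intro t ht i
      refine Fin.cases ⟨0, Or.inl rfl⟩ (fun i => ?_) i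
      simpa using ht i
    · refine Submodule.sub_mem _ (Submodule.sub_mem _ ?_ ?_) ?_
      · rw [mp_single]
        exact Finsupp.single_mem_supported K _ (fun i => ⟨i, Or.inr rfl⟩)
      · rw [mp_single]
        exact Finsupp.single_mem_supported K _ (fun i => ⟨i, Or.inl rfl⟩)
      · rw [bd_single, map_sum]
        refine Submodule.sum_mem _ fun k _ => ?_
        rw [map_smul]
        refine Submodule.smul_mem _ _ ?_
        refine Finsupp.supported_mono ?_ (ih (k.removeNth s))
        intro t ht i
        obtain ⟨j, hj⟩ := ht i
        exact ⟨k.succAbove j, hj⟩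

end chains

section fill
variable {K : Type*} [Field K] {A : Type*} [NormedAddCommGroup A] [NormedSpace ℝ A]

def Sm (X : Set A) (ε : ℝ) (n : ℕ) : Set (Fin n → A) :=
  {s | (∀ i, s i ∈ X) ∧ ∀ i j, dist (s i) (s j) < ε}

lemma fill (X : Set A) (hX : Convex ℝ X) (hb : Bornology.IsBounded X) (y : A) (hy : y ∈ X)
    (ε : ℝ) (hε : 0 < ε) (n : ℕ) (z : Ch K A (n+1))
    (hz : z ∈ Finsupp.supported K K (Sm X ε (n+1))) (hbz : bd n z = 0) :
    ∃ c ∈ Finsupp.supported K K (Sm X (2*ε) (n+2)), bd (n+1) c = z := by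
  obtain ⟨D, hD⟩ := (Metric.isBounded_iff_subset_closedBall y).1 hb
  have hD0 : 0 ≤ D := by
    have := hD hy
    simpa using this
  obtain ⟨N, hN⟩ := exists_nat_gt (D/ε)
  have hNpos : (0:ℝ) < N := lt_of_le_of_lt (by positivity) hN
  set s : ℕ → A → A := fun k x => AffineMap.lineMap x y ((k:ℝ)/N) with hs
  have hsX : ∀ k ≤ N, ∀ x ∈ X, s k x ∈ X := by
    intro k hk x hx
    refine hX.segment_subset hx hy ?_
    rw [segment_eq_image_lineMap]
    refine ⟨_, ⟨by positivity, ?_⟩, rfl⟩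
    rw [div_le_one hNpos]; exact_mod_cast hk
  have hsd : ∀ k ≤ N, ∀ x x', dist (s k x) (s k x') ≤ dist x x' := by
    intro k hk x x'
    have h1 : s k x - s k x' = (1 - (k:ℝ)/N) • (x - x') := by
      simp only [hs, AffineMap.lineMap_apply_module]; module
    rw [dist_eq_norm, dist_eq_norm, h1, norm_smul]
    have h2 : (k:ℝ)/N ≤ 1 := by rw [div_le_one hNpos]; exact_mod_cast hk
    have h3 : 0 ≤ (k:ℝ)/N := by positivity
    have : ‖1 - (k:ℝ)/N‖ ≤ 1 := by rw [Real.norm_eq_abs, abs_le]; constructor <;> linarith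
    calc _ ≤ 1 * ‖x - x'‖ := by gcongr
      _ = _ := one_mul _
  have hst : ∀ k, ∀ x ∈ X, dist (s k x) (s (k+1) x) < ε := by
    intro k x hx
    have h1 : s k x - s (k+1) x = (1/(N:ℝ)) • (x - y) := by
      simp only [hs, AffineMap.lineMap_apply_module]; push_cast; rw [add_div]; module
    rw [dist_eq_norm, h1, norm_smul]
    have h2 := hD hx
    rw [Metric.mem_closedBall, dist_eq_norm] at h2
    rw [Real.norm_of_nonneg (by positivity), one_div, inv_mul_lt_iff₀ hNpos]
    rw [div_lt_iff₀ hε] at hN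
    linarith
  have key : ∀ k ≤ N, ∃ c ∈ Finsupp.supported K K (Sm X (2*ε) (n+2)),
      bd (n+1) c = mp (s k) (n+1) z - z := by
    intro k
    induction k with
    | zero =>
      intro _
      refine ⟨0, Submodule.zero_mem _, ?_⟩
      have : s 0 = id := by funext x; simp [hs]
      have h2 : mp id (n+1) z = z := by
        simp only [mp, Function.id_comp]
        exact Finsupp.mapDomain_id
      rw [this, h2]; simp
    | succ k ih =>
      intro hk
      obtain ⟨c, hc, hbc⟩ := ih (by omega)
      refine ⟨c + hmt (s k) (s (k+1)) (n+1) z, Submodule.add_mem _ hc ?_, ?_⟩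
      · refine supp_ext _ (Sm X ε (n+1)) _ ?_ z hz
        intro t ht
        refine Finsupp.supported_mono ?_ (hmt_supp1 _ _ _ t)
        intro r hr
        refine ⟨fun i => ?_, fun i j => ?_⟩
        · obtain ⟨j, hj | hj⟩ := hr i <;> rw [hj]
          · exact hsX _ (by omega) _ (ht.1 j)
          · exact hsX _ hk _ (ht.1 j)
        · obtain ⟨a, ha⟩ := hr i
          obtain ⟨b, hb⟩ := hr j
          have h1 := ht.2 a b
          have h2 := hst k _ (ht.1 a)
          have h2' := hst k _ (ht.1 b)
          have h3 := hsd k (by omega) (t a) (t b)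
          have h4 := hsd (k+1) hk (t a) (t b)
          rcases ha with ha | ha <;> rcases hb with hb | hb <;> rw [ha, hb]
          · linarith
          · linarith [dist_triangle (s k (t a)) (s k (t b)) (s (k+1) (t b))]
          · have := dist_triangle (s (k+1) (t a)) (s k (t a)) (s k (t b))
            rw [dist_comm (s (k+1) (t a)) (s k (t a))] at this
            linarith
          · linarith
      · rw [map_add, hbc, bd_hmt, hbz, map_zero]; abel
  obtain ⟨c, hc, hbc⟩ := key N le_rfl
  refine ⟨cone y (n+1) (mp (s N) (n+1) z) - c, Submodule.sub_mem _ ?_ hc, ?_⟩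
  · have hsN : s N = fun _ => y := by
      funext x; simp [hs, div_self hNpos.ne']
    refine cone_supp _ _ _ {t | ∀ i, t i = y} _ ?_ (mp_supp _ _ _ (Sm X ε (n+1)) _ ?_ hz)
    · intro t ht
      have : ∀ i, (Fin.cons y t : Fin (n+2) → A) i = y := by
        intro i
        refine Fin.cases rfl (fun i => ?_) i
        simpa using ht i
      refine ⟨fun i => by rw [this]; exact hy, fun i j => ?_⟩
      rw [this, this, dist_self]; linarith
    · intro t _ i
      simp [hsN]
  · rw [map_sub, bd_cone, bd_mp, hbz, hbc]; simp

end fill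
section alt
variable {K : Type*} [Field K] {V : Type*}

def IsAlt (n : ℕ) (q : (Fin n → V) → K) : Prop :=
  ∀ s a b, a ≠ b → (q (s ∘ Equiv.swap a b) = - q s ∧ (s a = s b → q s = 0))

lemma IsAlt.lift [Fintype V] [DecidableEq V] {n : ℕ} {q : (Fin n → V) → K} (h : IsAlt n q) :
    ∃ F : (V → K) [⋀^Fin n]→ₗ[K] K, ∀ s : Fin n → V, F (fun i => Pi.single (s i) 1) = q s := by
  let m : MultilinearMap K (fun _ : Fin n => (V → K)) K :=
    ∑ s : Fin n → V, q s • (MultilinearMap.mkPiAlgebra K (Fin n) K).compLinearMap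
      (fun i => LinearMap.proj (s i))
  have hm : ∀ v, m v = ∑ s : Fin n → V, q s * ∏ i, v i (s i) := by
    intro v; simp [m]
  refine ⟨{ m with map_eq_zero_of_eq' := ?_ }, ?_⟩
  · intro v a b hab hne
    change m v = 0
    rw [hm]
    refine Finset.sum_involution (fun s _ => s ∘ Equiv.swap a b) ?_ ?_ ?_ ?_
    · intro s _
      rw [(h s a b hne).1]
      have : ∏ i, v i ((s ∘ Equiv.swap a b) i) = ∏ i, v i (s i) := by
        rw [← Equiv.prod_comp (Equiv.swap a b)]
        refine Finset.prod_congr rfl fun i _ => ?_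
        simp only [Function.comp_apply, Equiv.swap_apply_self]
        have hv : v (Equiv.swap a b i) = v i := by
          rcases eq_or_ne i a with rfl | h1
          · rw [Equiv.swap_apply_left, hab]
          rcases eq_or_ne i b with rfl | h2
          · rw [Equiv.swap_apply_right, hab]
          · rw [Equiv.swap_apply_of_ne_of_ne h1 h2]
        rw [hv]
      rw [this]; ring
    · intro s _ hs heq
      apply hs
      have h1 := congrFun heq a
      simp at h1
      rw [(h s a b hne).2 h1.symm, zero_mul]
    · intro s _; exact Finset.mem_univ _
    · intro s _
      funext i; simp
  · intro s
    change m _ = _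
    rw [hm, Finset.sum_eq_single s]
    · simp
    · intro t _ hts
      obtain ⟨i, hi⟩ := Function.ne_iff.1 hts
      rw [Finset.prod_eq_zero (Finset.mem_univ i), mul_zero]
      simp [hi]
    · intro h; exact absurd (Finset.mem_univ _) h

lemma IsAlt.of_lift [Fintype V] [DecidableEq V] {n : ℕ} {q : (Fin n → V) → K}
    (F : (V → K) [⋀^Fin n]→ₗ[K] K) (hF : ∀ s : Fin n → V, F (fun i => Pi.single (s i) 1) = q s) :
    IsAlt n q := by
  intro s a b hab
  rw [← hF, ← hF]
  refine ⟨F.map_swap (fun i => Pi.single (s i) 1) hab, fun h => F.map_eq_zero_of_eq _ ?_ hab⟩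
  simp [h]

lemma IsAlt.delta [Fintype V] [DecidableEq V] {n : ℕ} {q : Ch K V n →ₗ[K] K}
    (h : IsAlt n (fun s => q (Finsupp.single s 1))) :
    IsAlt (n+1) (fun s => (q ∘ₗ bd n) (Finsupp.single s 1)) := by
  obtain ⟨F, hF⟩ := h.lift
  let ε : (V → K) →ₗ[K] K := ∑ v, LinearMap.proj v
  refine IsAlt.of_lift (AlternatingMap.alternatizeUncurryFin (ε.smulRight F)) ?_
  intro s
  rw [AlternatingMap.alternatizeUncurryFin_apply]
  simp only [LinearMap.comp_apply, bd_single, map_sum, map_smul]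
  refine Finset.sum_congr rfl fun k _ => ?_
  have h1 : ε (Pi.single (s k) 1) = 1 := by
    simp [ε]
  have h2 := hF (k.removeNth s)
  rw [LinearMap.smulRight_apply, h1, one_smul, ← h2]
  rw [← Int.cast_smul_eq_zsmul K]
  push_cast
  rfl

/-! coloured vertices -/
variable {L p : ℕ}

def tau (v : Fin L × ZMod p) : Fin L × ZMod p := (v.1, v.2 + 1)

def Small (n : ℕ) : Set (Fin n → Fin L × ZMod p) := {s | ∀ a b, (s a).1 = (s b).1 → s a = s b}

lemma tau_iter (k : ℕ) (v : Fin L × ZMod p) : tau^[k] v = (v.1, v.2 + k) := by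
  induction k with
  | zero => simp
  | succ k ih => rw [Function.iterate_succ_apply', ih]; simp [tau, add_assoc]

def gam {n : ℕ} (s : Fin n → Fin L × ZMod p) : ZMod p :=
  Classical.epsilon (fun g => ∃ i, (i, g) ∈ Set.range s ∧ ∀ v ∈ Set.range s, i ≤ v.1)

lemma gam_spec {n : ℕ} (s : Fin (n+1) → Fin L × ZMod p) (hs : s ∈ Small (n+1)) (a : Fin (n+1))
    (ha : ∀ b, (s a).1 ≤ (s b).1) : gam s = (s a).2 := by
  have h : ∃ g : ZMod p, ∃ i, (i, g) ∈ Set.range s ∧ ∀ v ∈ Set.range s, i ≤ v.1 :=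
    ⟨(s a).2, (s a).1, ⟨a, rfl⟩, by rintro _ ⟨b, rfl⟩; exact ha b⟩
  obtain ⟨i, ⟨b, hb⟩, hi⟩ := Classical.epsilon_spec h
  change (s b) = (i, gam s) at hb
  have h1 : i = (s a).1 := le_antisymm (hi _ ⟨a, rfl⟩) (by have := ha b; rw [hb] at this; exact this)
  have h2 := hs a b (by rw [hb]; exact h1.symm)
  rw [h2, hb]

lemma exists_min {n : ℕ} (s : Fin (n+1) → Fin L × ZMod p) : ∃ a, ∀ b, (s a).1 ≤ (s b).1 := by
  obtain ⟨a, -, ha⟩ := Finset.exists_min_image Finset.univ (fun a => (s a).1) ⟨0, Finset.mem_univ _⟩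
  exact ⟨a, fun b => ha b (Finset.mem_univ b)⟩

lemma small_tau {n : ℕ} (s : Fin n → Fin L × ZMod p) (hs : s ∈ Small n) (k : ℕ) :
    tau^[k] ∘ s ∈ Small n := by
  intro a b h
  simp only [Function.comp_apply] at *
  have : (s a).1 = (s b).1 := by simpa [tau_iter] using h
  rw [hs a b this]

lemma gam_tau {n : ℕ} (s : Fin (n+1) → Fin L × ZMod p) (hs : s ∈ Small (n+1)) (k : ℕ) :
    gam (tau^[k] ∘ s) = gam s + k := by
  obtain ⟨a, ha⟩ := exists_min s
  rw [gam_spec s hs a ha, gam_spec _ (small_tau s hs k) a (by intro b; simpa [tau_iter] using ha b)]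
  simp [tau_iter]

lemma gam_swap {n : ℕ} (s : Fin n → Fin L × ZMod p) (a b : Fin n) :
    gam (s ∘ Equiv.swap a b) = gam s := by
  have : Set.range (s ∘ Equiv.swap a b) = Set.range s := (Equiv.swap a b).surjective.range_comp s
  unfold gam
  rw [this]

def fnl {n : ℕ} (q : (Fin n → V) → K) : Ch K V n →ₗ[K] K := Finsupp.linearCombination K q

lemma fnl_single {n : ℕ} (q : (Fin n → V) → K) (s) : fnl q (Finsupp.single s 1) = q s := by
  simp [fnl]

lemma exN [Fact p.Prime] (n : ℕ) (c : (Fin (n+1) → Fin L × ZMod p) → K) (hc : IsAlt (n+1) c)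
    (hinv : ∀ s ∈ Small (n+1), c (tau ∘ s) = c s) :
    ∃ e : (Fin (n+1) → Fin L × ZMod p) → K, IsAlt (n+1) e ∧
      ∀ s ∈ Small (n+1), ∑ k ∈ range p, e (tau^[k] ∘ s) = c s := by
  refine ⟨fun s => if gam s = 0 then c s else 0, ?_, ?_⟩
  · intro s a b hab
    obtain ⟨h1, h2⟩ := hc s a b hab
    simp only [gam_swap, h1]
    constructor
    · split_ifs <;> simp
    · intro h; simp [h2 h]
  · intro s hs
    have hk : ∀ k : ℕ, c (tau^[k] ∘ s) = c s := by
      intro k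
      induction k with
      | zero => rfl
      | succ k ih =>
        rw [Function.iterate_succ', Function.comp_assoc, hinv _ (small_tau s hs k), ih]
    simp only [gam_tau s hs, hk]
    rw [Finset.sum_ite, Finset.sum_const_zero, add_zero, Finset.sum_const]
    have : (range p).filter (fun k : ℕ => gam s + (k:ZMod p) = 0) = {(-gam s).val} := by
      ext k
      simp only [mem_filter, mem_range, mem_singleton]
      constructor
      · rintro ⟨h1, h2⟩
        rw [neg_eq_of_add_eq_zero_right h2, ZMod.val_cast_of_lt h1]
      · rintro rfl
        exact ⟨ZMod.val_lt _, by simp⟩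
    rw [this]; simp

lemma exT [Fact p.Prime] (n : ℕ) (c : (Fin (n+1) → Fin L × ZMod p) → K) (hc : IsAlt (n+1) c)
    (hinv : ∀ s ∈ Small (n+1), ∑ k ∈ range p, c (tau^[k] ∘ s) = 0) :
    ∃ e : (Fin (n+1) → Fin L × ZMod p) → K, IsAlt (n+1) e ∧
      ∀ s ∈ Small (n+1), e (tau ∘ s) - e s = c s := by
  refine ⟨fun s => ∑ k ∈ range (gam s).val, c (tau^[k + (p - (gam s).val)] ∘ s), ?_, ?_⟩
  · intro s a b hab
    constructor
    · simp only [gam_swap, ← Finset.sum_neg_distrib]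
      refine Finset.sum_congr rfl fun k _ => ?_
      rw [← Function.comp_assoc]
      exact (hc _ a b hab).1
    · intro h
      refine Finset.sum_eq_zero fun k _ => ?_
      exact (hc _ a b hab).2 (by simp [h])
  · intro s hs
    have hp : 0 < p := (Fact.out : p.Prime).pos
    have hg : gam (tau ∘ s) = gam s + 1 := by simpa using gam_tau s hs 1
    have hlt : (gam s).val < p := ZMod.val_lt _
    have hper : ∀ s : Fin (n+1) → Fin L × ZMod p, tau^[p] ∘ s = s := by
      intro s; funext a; simp [tau_iter]
    simp only [hg]
    by_cases h : (gam s).val + 1 < p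
    · have hv : (gam s + 1).val = (gam s).val + 1 := by
        have h0 : gam s + 1 = (((gam s).val + 1 : ℕ) : ZMod p) := by simp
        rw [h0, ZMod.val_cast_of_lt h]
      rw [hv, Finset.sum_range_succ]
      have h1 : ∀ k, k ≤ (gam s).val → tau^[k + (p - ((gam s).val + 1))] ∘ (tau ∘ s) =
          tau^[k + (p - (gam s).val)] ∘ s := by
        intro k hk
        rw [← Function.comp_assoc, ← Function.iterate_succ]
        congr 2; omega
      rw [h1 _ le_rfl]
      have h2 : (gam s).val + (p - (gam s).val) = p := by omega
      rw [h2, hper, Finset.sum_congr rfl (fun k hk => by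
        rw [h1 k (by rw [mem_range] at hk; omega)])]
      ring
    · have hv1 : (gam s).val = p - 1 := by omega
      have hv : (gam s + 1).val = 0 := by
        have : gam s = ((p - 1 : ℕ) : ZMod p) := by rw [← hv1]; simp
        rw [this]; 
        have h3 : ((p - 1 : ℕ) : ZMod p) + 1 = ((p - 1 + 1 : ℕ) : ZMod p) := by push_cast; rfl
        rw [h3, Nat.sub_add_cancel hp]; simp
      rw [hv, hv1]
      have h4 := hinv s hs
      obtain ⟨r, rfl⟩ : ∃ r, p = r + 1 := ⟨p - 1, by omega⟩
      rw [Finset.sum_range_succ'] at h4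
      simp only [Finset.range_zero, Finset.sum_empty, Nat.add_sub_cancel, 
        Nat.add_sub_cancel_left]
      simp only [Function.iterate_zero, Function.id_comp] at h4
      rw [zero_sub]
      exact neg_eq_of_add_eq_zero_right h4

end alt
end Smith

end

noncomputable section
namespace Smith
open Finset Polynomial
set_option linter.unusedSectionVars false

section step
variable {L p : ℕ} [Fact p.Prime]
variable {A : Type*} [NormedAddCommGroup A] [NormedSpace ℝ A] [FiniteDimensional ℝ A]

lemma mp_pow {K : Type*} [Field K] {B : Type*} (T : B → B) (n k : ℕ) :
    (mp T n : Module.End K (Ch K B n)) ^ k = mp T^[k] n := by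
  induction k with
  | zero =>
    refine Finsupp.lhom_ext' fun s => LinearMap.ext_ring ?_
    simp [mp_single]
  | succ k ih =>
    rw [pow_succ, ih]
    refine Finsupp.lhom_ext' fun s => LinearMap.ext_ring ?_
    simp [mp_single, Function.iterate_succ, Function.comp_assoc]

abbrev op {K : Type*} [Field K] {B : Type*} (T : B → B) (n : ℕ) (P : K[X]) :
    Module.End K (Ch K B n) := aeval (mp T n : Module.End K (Ch K B n)) P

lemma op_apply {K : Type*} [Field K] {B : Type*} (T : B → B) (n : ℕ) (P : K[X]) (z : Ch K B n) :
    op T n P z = ∑ k ∈ range (P.natDegree + 1), P.coeff k • mp T^[k] n z := by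
  rw [op, aeval_eq_sum_range]
  simp [mp_pow, LinearMap.sum_apply]

lemma bd_op {K : Type*} [Field K] {B : Type*} (T : B → B) (n : ℕ) (P : K[X]) (z : Ch K B (n+1)) :
    bd n (op T (n+1) P z) = op T n P (bd n z) := by
  simp only [op_apply, map_sum, map_smul, bd_mp]

lemma mp_op {K : Type*} [Field K] {B C : Type*} (T : B → B) (τ : C → C) (col : B → C)
    (h : ∀ b, col (T b) = τ (col b)) (n : ℕ) (P : K[X]) (z : Ch K B n) :
    mp col n (op T n P z) = op τ n P (mp col n z) := by
  have hk : ∀ k b, col (T^[k] b) = τ^[k] (col b) := by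
    intro k b
    induction k with
    | zero => rfl
    | succ k ih => rw [Function.iterate_succ_apply', h, ih, Function.iterate_succ_apply']
  simp only [op_apply, map_sum, map_smul]
  refine Finset.sum_congr rfl fun k _ => ?_
  congr 1
  simp only [mp, Finsupp.lmapDomain_apply, ← Finsupp.mapDomain_comp]
  congr 1
  funext s a
  exact hk _ _

lemma exists_ball (C : Set A) (h : IsCompact C) :
    ∃ Y : Set A, IsCompact Y ∧ Convex ℝ Y ∧ C ⊆ Y := by
  obtain ⟨R, hR⟩ := h.isBounded.subset_closedBall 0
  have : ProperSpace A := FiniteDimensional.proper ℝ A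
  exact ⟨_, isCompact_closedBall 0 R, convex_closedBall _ _, hR⟩

/-- two functionals agreeing on basis tuples of a set agree on chains supported there -/
lemma fn_ext {K : Type*} [Field K] {ι M : Type*} [AddCommGroup M] [Module K M]
    (F G : (ι →₀ K) →ₗ[K] M) (S : Set ι)
    (h : ∀ s ∈ S, F (Finsupp.single s 1) = G (Finsupp.single s 1)) (z : ι →₀ K)
    (hz : z ∈ Finsupp.supported K K S) : F z = G z := by
  rw [← Finsupp.sum_single z, Finsupp.sum, map_sum, map_sum]
  refine Finset.sum_congr rfl fun s hs => ?_
  have : Finsupp.single s (z s) = z s • Finsupp.single s (1:K) := by simp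
  rw [this, map_smul, map_smul, h s (hz hs)]

/-- exactness property for a pair of polynomials -/
def Ex (L p : ℕ) [Fact p.Prime] (P Q : (ZMod p)[X]) : Prop :=
  ∀ (n : ℕ) (c : Ch (ZMod p) (Fin L × ZMod p) (n+1) →ₗ[ZMod p] ZMod p),
    IsAlt (n+1) (fun s => c (Finsupp.single s 1)) →
    (∀ s ∈ Small (n+1), c (op tau (n+1) Q (Finsupp.single s 1)) = 0) →
    ∃ e : Ch (ZMod p) (Fin L × ZMod p) (n+1) →ₗ[ZMod p] ZMod p,
      IsAlt (n+1) (fun s => e (Finsupp.single s 1)) ∧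
      ∀ s ∈ Small (n+1), e (op tau (n+1) P (Finsupp.single s 1)) = c (Finsupp.single s 1)

def PT (p : ℕ) : (ZMod p)[X] := X - 1
def PN (p : ℕ) : (ZMod p)[X] := ∑ k ∈ range p, X ^ k

lemma op_PT {B : Type*} (T : B → B) (n : ℕ) (s : Fin n → B) :
    op T n (PT p) (Finsupp.single s 1) = Finsupp.single (T ∘ s) 1 - Finsupp.single s 1 := by
  simp [op, PT, mp_single]

lemma op_PN {B : Type*} (T : B → B) (n : ℕ) (s : Fin n → B) :
    op T n (PN p) (Finsupp.single s 1) = ∑ k ∈ range p, Finsupp.single (T^[k] ∘ s) 1 := by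
  simp [op, PN, mp_pow, mp_single]

lemma exT' : Ex L p (PT p) (PN p) := by
  intro n c hc h
  obtain ⟨e, he, he'⟩ := exT (p := p) n _ hc (by
    intro s hs
    have := h s hs
    rwa [op_PN, map_sum] at this)
  refine ⟨fnl e, by simpa only [fnl_single] using he, fun s hs => ?_⟩
  rw [op_PT, map_sub, fnl_single, fnl_single, he' s hs]

lemma exN' : Ex L p (PN p) (PT p) := by
  intro n c hc h
  obtain ⟨e, he, he'⟩ := exN (p := p) n _ hc (by
    intro s hs
    have := h s hs
    rwa [op_PT, map_sub, sub_eq_zero] at this)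
  refine ⟨fnl e, by simpa only [fnl_single] using he, fun s hs => ?_⟩
  rw [op_PN, map_sum]
  simp only [fnl_single, he' s hs]

lemma PTPN : PT p * PN p = X ^ p - 1 := mul_geom_sum _ _
lemma PNPT : PN p * PT p = X ^ p - 1 := geom_sum_mul _ _

lemma op_zero {B : Type*} (T : B → B) (hT : ∀ b, T^[p] b = b) (n : ℕ) (P Q : (ZMod p)[X])
    (h : P * Q = X ^ p - 1) (z : Ch (ZMod p) B n) : op T n P (op T n Q z) = 0 := by
  have : op T n (P * Q) = (0 : Module.End (ZMod p) (Ch (ZMod p) B n)) := by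
    rw [h]
    have h2 : T^[p] = id := funext hT
    have h3 : (mp T n : Module.End (ZMod p) (Ch (ZMod p) B n)) ^ p = 1 := by
      rw [mp_pow, h2]
      refine Finsupp.lhom_ext' fun s => LinearMap.ext_ring ?_
      simp [mp_single]
    simp [op, h3]
  rw [op, map_mul] at this
  exact LinearMap.congr_fun this z

structure Setup (L p : ℕ) (A : Type*) [NormedAddCommGroup A] where
  T : A → A
  hT : Continuous T
  hTp : ∀ a, T^[p] a = a
  col : A → Fin L × ZMod p
  hcol : ∀ a, col (T a) = tau (col a)
  loc : ∀ a, ∃ r > 0, ∀ b c, dist b a < r → dist c a < r → (col b).1 = (col c).1 → col b = col c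

variable (S : Setup L p A)

lemma Setup.leb (X : Set A) (hX : IsCompact X) : ∃ η > 0, ∀ b ∈ X, ∀ c ∈ X, dist b c < η →
    (S.col b).1 = (S.col c).1 → S.col b = S.col c := by
  choose r hr h using S.loc
  obtain ⟨η, hη, hl⟩ := lebesgue_number_lemma_of_metric (c := fun a : A => Metric.ball a (r a)) hX
    (fun _ => Metric.isOpen_ball) (fun x _ => Set.mem_iUnion.2 ⟨x, Metric.mem_ball_self (hr x)⟩)
  refine ⟨η, hη, fun b hb c _ hbc => ?_⟩
  obtain ⟨a, ha⟩ := hl b hb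
  refine h a b c (ha (Metric.mem_ball_self hη)) (ha ?_)
  rw [Metric.mem_ball, dist_comm]; exact hbc

def State (n : ℕ) (P Q : (ZMod p)[X]) : Prop :=
  ∃ q : Ch (ZMod p) (Fin L × ZMod p) (n+1) →ₗ[ZMod p] ZMod p,
    IsAlt (n+1) (fun s => q (Finsupp.single s 1)) ∧
    (∀ s ∈ Small (n+2), q (bd (n+1) (op tau (n+2) Q (Finsupp.single s 1))) = 0) ∧
    ∃ X : Set A, IsCompact X ∧ Convex ℝ X ∧ X.Nonempty ∧ ∀ ε > 0,
      ∃ z ∈ Finsupp.supported (ZMod p) (ZMod p) (Sm X ε (n+1)), bd n z = 0 ∧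
        op S.T (n+1) P z = 0 ∧ q (mp S.col (n+1) z) = 1

lemma Setup.unif (X : Set A) (hX : IsCompact X) (m : ℕ) (ε : ℝ) (hε : 0 < ε) :
    ∃ δ > 0, ∀ k ≤ m, ∀ b ∈ X, ∀ c ∈ X, dist b c < δ → dist (S.T^[k] b) (S.T^[k] c) < ε := by
  induction m with
  | zero => exact ⟨ε, hε, fun k hk b _ c _ h => by
      obtain rfl : k = 0 := by omega
      simpa using h⟩
  | succ m ih =>
    obtain ⟨δ, hδ, h⟩ := ih
    have hu := hX.uniformContinuousOn_of_continuous (S.hT.iterate (m+1)).continuousOn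
    obtain ⟨δ', hδ', h'⟩ := Metric.uniformContinuousOn_iff.1 hu ε hε
    refine ⟨min δ δ', lt_min hδ hδ', fun k hk b hb c hc hbc => ?_⟩
    rcases Nat.lt_or_ge k (m+1) with h1 | h1
    · exact h k (by omega) b hb c hc (lt_of_lt_of_le hbc (min_le_left _ _))
    · obtain rfl : k = m + 1 := by omega
      exact h' b hb c hc (lt_of_lt_of_le hbc (min_le_right _ _))

lemma bd_small {n : ℕ} (s : Fin (n+1) → Fin L × ZMod p) (hs : s ∈ Small (n+1)) :
    bd n (Finsupp.single s (1 : ZMod p)) ∈ Finsupp.supported (ZMod p) (ZMod p) (Small n) := by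
  rw [bd_single]
  refine Submodule.sum_mem _ fun k _ => Submodule.smul_mem _ _ ?_
  refine Finsupp.single_mem_supported _ _ ?_
  intro a b h
  exact hs _ _ h

lemma State.step {n : ℕ} {P Q : (ZMod p)[X]} (hPQ : Q * P = X ^ p - 1)
    (hex : Ex L p P Q) (h : State S n P Q) : State S (n+1) Q P := by
  obtain ⟨q, hq, hqi, X, hXc, hXv, ⟨y, hy⟩, hz⟩ := h
  obtain ⟨e, he, hee⟩ := hex (n+1) (q ∘ₗ bd (n+1)) hq.delta hqi
  obtain ⟨Y, hYc, hYv, hYs⟩ := exists_ball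
    (⋃ k ∈ (range (P.natDegree+1) : Finset ℕ), S.T^[k] '' X)
    (Finset.isCompact_biUnion _ fun k _ => hXc.image (S.hT.iterate k))
  refine ⟨e, he, ?_, Y, hYc, hYv, ?_, ?_⟩
  · intro s hs
    rw [bd_op]
    have := fn_ext (e ∘ₗ op tau (n+2) P) (q ∘ₗ bd (n+1)) (Small (n+2)) (fun s hs => hee s hs)
      (bd (n+2) (Finsupp.single s 1)) (bd_small s hs)
    simp only [LinearMap.comp_apply] at this
    rw [this, bd_bd, map_zero]
  · refine ⟨y, hYs ?_⟩
    simp only [Set.mem_iUnion]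
    exact ⟨0, by simp, y, hy, rfl⟩
  · intro ε hε
    obtain ⟨η, hη, hηl⟩ := S.leb X hXc
    obtain ⟨δ, hδ, hδu⟩ := S.unif X hXc P.natDegree ε hε
    have hm : 0 < min η δ / 2 := by positivity
    obtain ⟨z, hzs, hbz, hPz, hqz⟩ := hz _ hm
    obtain ⟨c, hc, hbc⟩ := fill X hXv hXc.isBounded y hy _ hm n z hzs hbz
    have h2 : 2 * (min η δ / 2) = min η δ := by ring
    rw [h2] at hc
    refine ⟨op S.T (n+2) P c, ?_, ?_, ?_, ?_⟩
    · rw [op_apply]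
      refine Submodule.sum_mem _ fun k hk => Submodule.smul_mem _ _ ?_
      refine mp_supp _ _ _ _ _ ?_ hc
      intro s hs
      refine ⟨fun i => hYs ?_, fun i j => ?_⟩
      · simp only [Set.mem_iUnion]
        exact ⟨k, hk, s i, hs.1 i, rfl⟩
      · exact hδu k (by rw [mem_range] at hk; omega) _ (hs.1 i) _ (hs.1 j)
          (lt_of_lt_of_le (hs.2 i j) (min_le_right _ _))
    · rw [bd_op, hbc, hPz]
    · exact op_zero _ S.hTp _ _ _ hPQ _
    · rw [mp_op S.T tau S.col S.hcol]
      have hsm : mp S.col (n+2) c ∈ Finsupp.supported (ZMod p) (ZMod p) (Small (n+2)) := by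
        refine mp_supp _ _ _ _ _ ?_ hc
        intro s hs a b hab
        exact hηl _ (hs.1 a) _ (hs.1 b) (lt_of_lt_of_le (hs.2 a b) (min_le_left _ _)) hab
      have := fn_ext (e ∘ₗ op tau (n+2) P) (q ∘ₗ bd (n+1)) (Small (n+2)) (fun s hs => hee s hs)
        _ hsm
      simp only [LinearMap.comp_apply] at this
      rw [this, bd_mp, hbc, hqz]

lemma State.base : State S 0 (PT p) (PN p) := by
  obtain ⟨q, hq, hqq⟩ := exN' (L := L) (p := p) 0 (fnl fun _ => 1) (by
    intro s a b hab
    exact absurd (Fin.ext (by omega)) hab) (by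
    intro s hs
    rw [op_PT, map_sub, fnl_single, fnl_single, sub_self])
  obtain ⟨Y, hYc, hYv, hYs⟩ := exists_ball
    (⋃ k ∈ range p, {S.T^[k] 0})
    (Finset.isCompact_biUnion _ fun k _ => isCompact_singleton)
  refine ⟨q, hq, ?_, Y, hYc, hYv, ?_, ?_⟩
  · intro s hs
    rw [bd_op]
    have := fn_ext (q ∘ₗ op tau 1 (PN p)) (fnl fun _ => 1) (Small 1) (fun s hs => hqq s hs)
      (bd 1 (Finsupp.single s 1)) (bd_small s hs)
    simp only [LinearMap.comp_apply] at this
    rw [this, bd_single, map_sum]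
    simp only [map_smul, fnl_single]
    simp
  · refine ⟨S.T^[0] 0, hYs ?_⟩
    simp only [Set.mem_iUnion]
    exact ⟨0, by simpa using (Fact.out : p.Prime).pos, rfl⟩
  · intro ε hε
    refine ⟨op S.T 1 (PN p) (Finsupp.single (fun _ => 0) 1), ?_, ?_, ?_, ?_⟩
    · rw [op_PN]
      refine Submodule.sum_mem _ fun k hk => Finsupp.single_mem_supported _ _ ?_
      refine ⟨fun i => hYs ?_, fun i j => by simpa using hε⟩
      simp only [Set.mem_iUnion]
      exact ⟨k, hk, rfl⟩
    · rw [bd_op, bd_single]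
      have : ∀ z : Ch (ZMod p) A 0, op S.T 0 (PN p) z = 0 := by
        intro z
        have h1 : ∀ s : Fin 0 → A, op S.T 0 (PN p) (Finsupp.single s 1) = 0 := by
          intro s
          rw [op_PN]
          have : ∀ k, S.T^[k] ∘ s = s := fun k => Subsingleton.elim _ _
          simp only [this, Finset.sum_const, card_range]
          rw [← Nat.cast_smul_eq_nsmul (ZMod p)]; simp
        exact fn_ext (op S.T 0 (PN p)) 0 Set.univ (fun s _ => by rw [h1]; rfl) z (by simp)
      exact this _
    · exact op_zero _ S.hTp _ _ _ PTPN _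
    · rw [mp_op S.T tau S.col S.hcol, mp_single, hqq, fnl_single]
      intro a b _
      rfl

theorem Setup.false {L p : ℕ} [Fact p.Prime] {A : Type*} [NormedAddCommGroup A] [NormedSpace ℝ A]
    [FiniteDimensional ℝ A] (S : Setup L p A) : False := by
  have key : ∀ n, State S (2*n) (PT p) (PN p) := by
    intro n
    induction n with
    | zero => exact State.base S
    | succ n ih => exact (ih.step S PNPT exT').step S PTPN exN'
  obtain ⟨q, hq, -, X, hXc, -, -, hz⟩ := key L
  obtain ⟨η, hη, hηl⟩ := S.leb X hXc
  obtain ⟨z, hzs, -, -, hqz⟩ := hz η hη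
  have hsm : mp S.col (2*L+1) z ∈ Finsupp.supported (ZMod p) (ZMod p) (Small (2*L+1)) := by
    refine mp_supp _ _ _ _ _ ?_ hzs
    intro s hs a b hab
    exact hηl _ (hs.1 a) _ (hs.1 b) (hs.2 a b) hab
  have := fn_ext q 0 (Small (2*L+1)) (by
    intro s hs
    obtain ⟨a, b, hab, h⟩ := Fintype.exists_ne_map_eq_of_card_lt (fun a => (s a).1) (by simp; omega)
    simpa using (hq s a b hab).2 (hs a b h)) _ hsm
  rw [hqz] at this
  simp at this

end step
end Smith

end

noncomputable section
namespace Smith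
open Finset

theorem smith {p : ℕ} [Fact p.Prime] {A : Type*} [NormedAddCommGroup A] [NormedSpace ℝ A]
    [FiniteDimensional ℝ A] {E : Type*} [NormedAddCommGroup E] [NormedSpace ℂ E]
    [FiniteDimensional ℂ E] (ζ : ℂ) (hζ : IsPrimitiveRoot ζ p) (T : A → A) (hT : Continuous T)
    (hTp : ∀ a, T^[p] a = a) (r : A → E) (hr : Continuous r) (h0 : ∀ a, r a ≠ 0)
    (heq : ∀ a, r (T a) = ζ • r a) : False := by
  have hpp : p.Prime := Fact.out
  set χ := AddChar.zmodChar p hζ.pow_eq_one with hχ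
  have hχ1 : χ 1 = ζ := by
    rw [hχ, AddChar.zmodChar_apply, ZMod.val_one, pow_one]
  have hζn : ‖ζ‖ = 1 := hζ.norm'_eq_one hpp.pos.ne'
  have hχn : ∀ g, ‖χ g‖ = 1 := fun g => by rw [hχ, AddChar.zmodChar_apply, norm_pow, hζn, one_pow]
  have hχi : ∀ g, χ g = 1 → g = 0 := fun g h => by
    rw [hχ, AddChar.zmodChar_apply, hζ.pow_eq_one_iff_dvd] at h
    have := Nat.eq_zero_of_dvd_of_lt h (ZMod.val_lt g)
    exact (ZMod.val_eq_zero g).1 this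
  obtain ⟨δ, hδ, hδg⟩ : ∃ δ > 0, ∀ g : ZMod p, g ≠ 0 → 4 * δ ≤ ‖χ g - 1‖ := by
    have hne : (univ.filter (fun g : ZMod p => g ≠ 0)).Nonempty := ⟨1, by simp⟩
    obtain ⟨g, hg, hm⟩ := exists_min_image _ (fun g => ‖χ g - 1‖) hne
    have : 0 < ‖χ g - 1‖ := norm_pos_iff.2 fun h => by
      simp only [mem_filter, mem_univ, true_and] at hg
      exact hg (hχi _ (sub_eq_zero.1 h))
    refine ⟨‖χ g - 1‖ / 4, by positivity, fun g' hg' => ?_⟩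
    have := hm g' (by simpa using hg')
    linarith
  have hδ2 : ∀ g h : ZMod p, ∀ z : E, ‖z‖ = 1 → ‖χ g • z - χ h • z‖ < 4 * δ → g = h := by
    intro g h z hz hlt
    by_contra hgh
    have h1 := hδg (g - h) (sub_ne_zero.2 hgh)
    have h2 : χ g - χ h = χ h * (χ (g - h) - 1) := by
      rw [mul_sub, mul_one, ← AddChar.map_add_eq_mul, add_sub_cancel]
    rw [← sub_smul, norm_smul, hz, mul_one, h2, norm_mul, hχn, one_mul] at hlt
    linarith
  set q : A → E := fun a => ((‖r a‖⁻¹ : ℝ) : ℂ) • r a with hq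
  have hqc : Continuous q := by
    refine Continuous.smul ?_ hr
    exact Complex.continuous_ofReal.comp (hr.norm.inv₀ fun a => norm_ne_zero_iff.2 (h0 a))
  have hqn : ∀ a, ‖q a‖ = 1 := fun a => by
    have := norm_ne_zero_iff.2 (h0 a)
    simp only [hq, norm_smul, Complex.norm_real, norm_inv, norm_norm]
    field_simp
  have hqT : ∀ a, q (T a) = ζ • q a := fun a => by
    simp only [hq, heq, norm_smul, hζn, one_mul]
    rw [smul_comm]
  have : ProperSpace E := FiniteDimensional.proper ℂ E
  obtain ⟨t, hts, htf, htc⟩ := (isCompact_sphere (0:E) 1).finite_cover_balls hδ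
  obtain ⟨L, ⟨en⟩⟩ : ∃ L, Nonempty (Fin L ≃ t) := by
    have := htf.to_subtype
    obtain ⟨L, ⟨e⟩⟩ := Finite.exists_equiv_fin t
    exact ⟨L, ⟨e.symm⟩⟩
  set z : Fin L → E := fun i => (en i : E) with hz
  have hzn : ∀ i, ‖z i‖ = 1 := fun i => by simpa using hts (en i).2
  set I : A → Set (Fin L) := fun a => {i | ∃ g, ‖q a - χ g • z i‖ < δ} with hI
  have hIn : ∀ a, (I a).Nonempty := fun a => by
    have := htc (show q a ∈ Metric.sphere 0 1 by simpa using hqn a)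
    simp only [Set.mem_iUnion] at this
    obtain ⟨x, hx, hxa⟩ := this
    refine ⟨en.symm ⟨x, hx⟩, 0, ?_⟩
    rw [← dist_eq_norm]
    simpa [hz] using hxa
  have hTg : ∀ a i g, ‖q a - χ g • z i‖ < δ → ‖q (T a) - χ (g + 1) • z i‖ < δ := by
    intro a i g h
    rw [hqT, AddChar.map_add_eq_mul, hχ1, mul_comm, mul_smul, ← smul_sub, norm_smul, hζn, one_mul]
    exact h
  have hTg' : ∀ a i g, ‖q (T a) - χ g • z i‖ < δ → ‖q a - χ (g - 1) • z i‖ < δ := by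
    intro a i g h
    have : χ g = ζ * χ (g - 1) := by
      rw [← hχ1, ← AddChar.map_add_eq_mul, add_sub_cancel]
    rw [hqT, this, mul_smul, ← smul_sub, norm_smul, hζn, one_mul] at h
    exact h
  have hIT : ∀ a, I (T a) = I a := fun a => by
    ext i
    exact ⟨fun ⟨g, h⟩ => ⟨_, hTg' _ _ _ h⟩, fun ⟨g, h⟩ => ⟨_, hTg _ _ _ h⟩⟩
  choose F hF using fun s : {s : Set (Fin L) // s.Nonempty} => s.2
  set c : A → Fin L := fun a => F ⟨I a, hIn a⟩ with hc
  have hcT : ∀ a, c (T a) = c a := fun a => by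
    simp only [hc, hIT]
  have hcI : ∀ a, c a ∈ I a := fun a => hF ⟨I a, hIn a⟩
  choose G hG using hcI
  refine Setup.false (L := L) (p := p) (A := A) ⟨T, hT, hTp, fun a => (c a, G a), ?_, ?_⟩
  · intro a
    have h1 := hG (T a)
    have h2 := hTg _ _ _ (hG a)
    rw [hcT] at h1
    have : G (T a) = G a + 1 := hδ2 _ _ (z (c a)) (hzn _) (by
      have := norm_sub_le_norm_sub_add_norm_sub (χ (G (T a)) • z (c a)) (q (T a)) (χ (G a + 1) • z (c a))
      rw [norm_sub_rev _ (q (T a))] at this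
      linarith)
    simp [tau, hcT, this]
  · intro a
    obtain ⟨s, hs, hsb⟩ := Metric.continuousAt_iff.1 hqc.continuousAt (δ / 2) (half_pos hδ)
    refine ⟨s, hs, fun b b' hb hb' hcc => ?_⟩
    simp only at hcc
    have h1 := hG b
    have h2 := hG b'
    rw [← hcc] at h2
    have e1 := hsb hb
    have e2 := hsb hb'
    rw [dist_eq_norm] at e1 e2
    have : G b = G b' := hδ2 _ _ (z (c b)) (hzn _) (by
      have a1 := norm_sub_le_norm_sub_add_norm_sub (χ (G b) • z (c b)) (q b) (χ (G b') • z (c b))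
      have a2 := norm_sub_le_norm_sub_add_norm_sub (q b) (q b') (χ (G b') • z (c b))
      have a3 := norm_sub_le_norm_sub_add_norm_sub (q b) (q a) (q b')
      rw [norm_sub_rev _ (q b)] at a1
      rw [norm_sub_rev (q a) (q b')] at a3
      linarith)
    exact Prod.ext hcc this

end Smith

end

noncomputable section
namespace Smith
open Complex

lemma log_lift {A : Type*} [NormedAddCommGroup A] [NormedSpace ℝ A] (F : A → ℂ)
    (hF : Continuous F) (h0 : ∀ a, F a ≠ 0) : ∃ U : A → ℂ, Continuous U ∧ ∀ a, exp (U a) = F a := by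
  have : ContractibleSpace A := RealTopologicalVectorSpace.contractibleSpace
  obtain ⟨G, ⟨_, hG⟩, -⟩ := isCoveringMap_exp.existsUnique_continuousMap_lifts
    (⟨fun a => ⟨F a, h0 a⟩, by fun_prop⟩ : C(A, {z : ℂ // z ≠ 0})) 0 (log (F 0))
    (by simp [exp_log (h0 0)])
  refine ⟨G, G.continuous, fun a => ?_⟩
  simpa using congrArg Subtype.val (congrFun hG a)

lemma log_unique {A : Type*} [TopologicalSpace A] [PreconnectedSpace A] (a b : A → ℂ)
    (ha : Continuous a) (hb : Continuous b) (h : ∀ x, exp (a x) = exp (b x)) (x₀ : A)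
    (h0 : a x₀ = b x₀) : a = b := by
  refine isCoveringMap_exp.eq_of_comp_eq ha hb ?_ x₀ h0
  funext x
  exact Subtype.ext (h x)

lemma log_unique' {A : Type*} [TopologicalSpace A] [PreconnectedSpace A] [Nonempty A] (a b : A → ℂ)
    (ha : Continuous a) (hb : Continuous b) (h : ∀ x, exp (a x) = exp (b x)) :
    ∃ n : ℤ, ∀ x, a x = b x + n * (2 * Real.pi * I) := by
  obtain ⟨x₀⟩ := ‹Nonempty A›
  obtain ⟨n, hn⟩ := exp_eq_exp_iff_exists_int.1 (h x₀)
  refine ⟨n, fun x => congrFun (log_unique a (fun x => b x + n * (2 * Real.pi * I)) ha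
    (hb.add continuous_const) (fun x => ?_) x₀ hn) x⟩
  rw [h, exp_add, exp_int_mul_two_pi_mul_I, mul_one]

/-- winding comparison -/
lemma wind_eq (a b q : ℝ → ℂ) (ha : Continuous a) (hb : Continuous b) (hq : Continuous q)
    (h : ∀ t, exp (a t) = q t * exp (b t)) (hq1 : ∀ t, ‖q t - 1‖ < 1) (t₀ t₁ : ℝ)
    (hp : q t₀ = q t₁) : a t₁ - a t₀ = b t₁ - b t₀ := by
  have hs : ∀ t, q t ∈ slitPlane := fun t => by
    have := mem_slitPlane_of_norm_lt_one (hq1 t)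
    simpa using this
  have hl : Continuous fun t => log (q t) := hq.clog hs
  obtain ⟨n, hn⟩ := log_unique' a (fun t => log (q t) + b t) ha (hl.add hb) (fun t => by
    rw [h, exp_add, exp_log (slitPlane_ne_zero (hs t))])
  rw [hn, hn, hp]; ring

section
variable {E : Type*} [NormedAddCommGroup E] [NormedSpace ℂ E]

abbrev AA (ℓ : E →L[ℂ] ℂ) := ℂ × (LinearMap.ker ℓ.toLinearMap)

def cd (ℓ : E →L[ℂ] ℂ) (w : E) (a : AA ℓ) : E := exp a.1 • w + (a.2 : E)

variable (ℓ : E →L[ℂ] ℂ) (w : E) (hw : ℓ w = 1)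

lemma cd_cont : Continuous (cd ℓ w) := by
  unfold cd
  fun_prop

include hw
lemma ell_cd (a : AA ℓ) : ℓ (cd ℓ w a) = exp a.1 := by
  have : ℓ (a.2 : E) = 0 := a.2.2
  simp [cd, hw, this]

lemma ell_cd_ne (a : AA ℓ) : ℓ (cd ℓ w a) ≠ 0 := by
  rw [ell_cd ℓ w hw]; exact exp_ne_zero _

def pr (y : E) : (LinearMap.ker ℓ.toLinearMap) := ⟨y - ℓ y • w, by simp [hw]⟩

lemma pr_cont : Continuous (pr ℓ w hw) := by
  unfold pr
  fun_prop

lemma cd_pr (s : ℂ) (y : E) (h : exp s = ℓ y) : cd ℓ w (s, pr ℓ w hw y) = y := by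
  simp [cd, pr, h]

lemma cd_inj (a b : AA ℓ) (h : cd ℓ w a = cd ℓ w b) : exp a.1 = exp b.1 ∧ a.2 = b.2 := by
  have h1 : exp a.1 = exp b.1 := by rw [← ell_cd ℓ w hw, ← ell_cd ℓ w hw, h]
  refine ⟨h1, ?_⟩
  simp only [cd, h1] at h
  exact Subtype.ext (add_left_cancel h)
omit hw

lemma cd_per (s : ℂ) (y : LinearMap.ker ℓ.toLinearMap) (n : ℤ) :
    cd ℓ w (s + n * (2 * Real.pi * I), y) = cd ℓ w (s, y) := by
  simp only [cd]
  rw [exp_add, exp_int_mul_two_pi_mul_I, mul_one]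

lemma period (G : E → ℂ) (U : AA ℓ → ℂ) (hU : Continuous U)
    (h : ∀ a, exp (U a) = G (cd ℓ w a)) :
    ∃ k : ℤ, ∀ (n : ℤ) s y, U (s + n * (2 * Real.pi * I), y) = U (s, y) + (n * k : ℤ) * (2 * Real.pi * I) := by
  have : PreconnectedSpace (AA ℓ) := inferInstance
  obtain ⟨k, hk⟩ := log_unique' (fun a : AA ℓ => U (a.1 + (1:ℤ) * (2 * Real.pi * I), a.2)) U
    (by fun_prop) hU (fun a => by rw [h, h, cd_per])
  have hk' : ∀ s y, U (s + 2 * Real.pi * I, y) = U (s, y) + k * (2 * Real.pi * I) := fun s y => by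
    simpa using hk (s, y)
  refine ⟨k, fun n s y => ?_⟩
  induction n using Int.induction_on with
  | zero => simp
  | succ n ih =>
    have := hk' (s + n * (2 * Real.pi * I)) y
    push_cast at ih ⊢
    rw [show s + ((n:ℂ) + 1) * (2 * Real.pi * I) = s + n * (2 * Real.pi * I) + 2 * Real.pi * I by ring,
      this, ih]; ring
  | pred n ih =>
    have := hk' (s + (-n - 1) * (2 * Real.pi * I)) y
    rw [show s + (-(n:ℂ) - 1) * (2 * Real.pi * I) + 2 * Real.pi * I = s + -n * (2 * Real.pi * I) by ring] at this
    push_cast at ih ⊢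
    rw [ih] at this
    linear_combination -this

theorem endgame [FiniteDimensional ℂ E] (hw : ℓ w = 1) (χ Ψ : E → E) (hχ : Continuous χ) (hΨ : Continuous Ψ)
    (hχΨ : ∀ x, χ (Ψ x) = x) (hΨχ : ∀ x, Ψ (χ x) = x) (h : E → ℂ) (m : ℕ) (hm : 2 ≤ m)
    (hh : ∀ (c : ℂ) x, h (c • x) = c ^ m * h x) (hz : ∀ x, h x = 0 ↔ ℓ (Ψ x) = 0)
    (U : AA ℓ → ℂ) (hU : Continuous U) (hUh : ∀ a, exp (U a) = h (χ (cd ℓ w a)))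
    (k l : ℤ) (hkl : k * l = 1)
    (hk : ∀ (n : ℤ) s y, U (s + n * (2 * Real.pi * I), y) = U (s, y) + (n * k : ℤ) * (2 * Real.pi * I)) :
    False := by
  set p := m.minFac with hp
  have hpp : p.Prime := Nat.minFac_prime (by omega)
  haveI : Fact p.Prime := ⟨hpp⟩
  set ζ := exp (2 * Real.pi * I / p) with hζd
  have hζ : IsPrimitiveRoot ζ p := isPrimitiveRoot_exp p hpp.ne_zero
  have hζm : ζ ^ m = 1 := by
    rw [hζ.pow_eq_one_iff_dvd]; exact Nat.minFac_dvd m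
  have hinv : ∀ x, h (ζ • x) = h x := fun x => by rw [hh, hζm, one_mul]
  set Pi : AA ℓ → E := fun a => χ (cd ℓ w a) with hPi
  have hPic : Continuous Pi := hχ.comp (cd_cont ℓ w)
  have hne : ∀ a, h (Pi a) ≠ 0 := fun a => by rw [← hUh]; exact exp_ne_zero _
  set Y : AA ℓ → E := fun a => Ψ (ζ • Pi a) with hY
  have hYc : Continuous Y := hΨ.comp (hPic.const_smul ζ)
  have hY0 : ∀ a, ℓ (Y a) ≠ 0 := fun a h0 => hne a (by
    rw [← hinv]; exact (hz _).2 h0)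
  obtain ⟨S, hSc, hS⟩ := log_lift (fun a => ℓ (Y a)) (ℓ.continuous.comp hYc) hY0
  set T₀ : AA ℓ → AA ℓ := fun a => (S a, pr ℓ w hw (Y a)) with hT0
  have hT0c : Continuous T₀ := hSc.prodMk ((pr_cont ℓ w hw).comp hYc)
  have hcdT : ∀ a, cd ℓ w (T₀ a) = Y a := fun a => cd_pr ℓ w hw _ _ (hS a)
  have hPT : ∀ a, Pi (T₀ a) = ζ • Pi a := fun a => by
    simp only [hPi, hcdT]; simp only [hY, hχΨ, hPi]
  obtain ⟨c, hc⟩ := log_unique' (fun a => U (T₀ a)) U (hU.comp hT0c) hU (fun a => by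
    rw [hUh, hUh]
    have := hPT a
    simp only [hPi] at this
    rw [this, hinv])
  set T : AA ℓ → AA ℓ := fun a => (S a + ((-(c * l) : ℤ) : ℂ) * (2 * Real.pi * I), pr ℓ w hw (Y a)) with hT
  have hTc : Continuous T := (hSc.add continuous_const).prodMk ((pr_cont ℓ w hw).comp hYc)
  have hTU : ∀ a, U (T a) = U a := fun a => by
    have h1 := hc a
    simp only [hT0] at h1
    simp only [hT]
    rw [hk, h1]
    have : -(c * l) * k = - c := by linear_combination (-c) * hkl
    rw [this]; push_cast; ring
  have hTP : ∀ a, Pi (T a) = ζ • Pi a := fun a => by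
    rw [← hPT]
    simp only [hPi, hT, cd_per, hT0]
  have hTUn : ∀ n a, U (T^[n] a) = U a := by
    intro n
    induction n with
    | zero => intro a; rfl
    | succ n ih => intro a; rw [Function.iterate_succ_apply', hTU, ih]
  have hTPn : ∀ n a, Pi (T^[n] a) = ζ ^ n • Pi a := by
    intro n
    induction n with
    | zero => intro a; simp
    | succ n ih => intro a; rw [Function.iterate_succ_apply', hTP, ih, smul_smul, pow_succ']
  refine smith ζ hζ T hTc (fun a => ?_) Pi hPic (fun a h0 => ?_) hTP
  · have h1 := hTPn p a
    rw [hζ.pow_eq_one, one_smul] at h1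
    have h2 := congrArg Ψ h1
    simp only [hPi, hΨχ] at h2
    obtain ⟨h3, h4⟩ := cd_inj ℓ w hw _ _ h2
    obtain ⟨e, he⟩ := exp_eq_exp_iff_exists_int.1 h3
    have h5 := hTUn p a
    have h6 : T^[p] a = (a.1 + e * (2 * Real.pi * I), a.2) := Prod.ext he h4
    rw [h6, hk] at h5
    have h7 : ((e * k : ℤ) : ℂ) * (2 * Real.pi * I) = 0 := by
      linear_combination h5
    rw [mul_eq_zero, or_iff_left two_pi_I_ne_zero, Int.cast_eq_zero] at h7
    have h8 : e = 0 := by linear_combination l * h7 - e * hkl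
    rw [h6, h8]; simp
  · apply hne a
    rw [h0]
    have := hh 0 0
    rw [zero_pow (by omega), zero_mul, smul_zero] at this
    exact this

end
end Smith

end

noncomputable section
namespace Smith
open Complex Filter Topology

lemma poly_bound (P : Polynomial ℂ) (D : ℕ) (hD : P.natDegree ≤ D) (ρ : ℝ) (hρ : 0 < ρ)
    (h : ∀ t : ℂ, ‖t‖ < ρ → P.eval t ≠ 0) (t : ℂ) :
    ‖P.eval t‖ ≤ ‖P.eval 0‖ * (1 + ‖t‖ / ρ) ^ D := by
  have hs := IsAlgClosed.splits P
  have he : ∀ s : ℂ, P.eval s = P.leadingCoeff * (P.roots.map fun a => s - a).prod := fun s => by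
    conv_lhs => rw [hs.eq_prod_roots]
    simp [Polynomial.eval_mul, Polynomial.eval_multiset_prod, Multiset.map_map]
  have hb : (1:ℝ) ≤ 1 + ‖t‖ / ρ := by
    have : 0 ≤ ‖t‖ / ρ := by positivity
    linarith
  have key : ∀ S : Multiset ℂ, (∀ a ∈ S, ρ ≤ ‖a‖) →
      ‖(S.map fun a => t - a).prod‖ ≤ ‖(S.map fun a => 0 - a).prod‖ * (1 + ‖t‖ / ρ) ^ (Multiset.card S) := by
    intro S
    induction S using Multiset.induction_on with
    | empty => simp
    | cons a S ih =>
      intro hS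
      have h1 := ih fun b hb => hS b (Multiset.mem_cons_of_mem hb)
      have h2 := hS a (Multiset.mem_cons_self a S)
      have h3 : ‖t - a‖ ≤ ‖0 - a‖ * (1 + ‖t‖ / ρ) := by
        have e1 := norm_sub_le t a
        have e2 : ‖t‖ ≤ ‖a‖ * (‖t‖ / ρ) := by
          rw [mul_div_assoc', le_div_iff₀ hρ]
          nlinarith [norm_nonneg t]
        simp only [zero_sub, norm_neg]
        linarith
      simp only [Multiset.map_cons, Multiset.prod_cons, norm_mul, Multiset.card_cons, pow_succ]
      calc _ ≤ (‖0 - a‖ * (1 + ‖t‖ / ρ)) * (‖(S.map fun a => 0 - a).prod‖ * (1 + ‖t‖ / ρ) ^ (Multiset.card S)) :=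
            mul_le_mul h3 h1 (norm_nonneg _) (by positivity)
        _ = _ := by ring
  have hr : ∀ a ∈ P.roots, ρ ≤ ‖a‖ := fun a ha => by
    by_contra hlt
    exact h a (not_le.1 hlt) (Polynomial.isRoot_of_mem_roots ha)
  have := key P.roots hr
  rw [he t, he 0, norm_mul, norm_mul, mul_assoc]
  refine mul_le_mul_of_nonneg_left (this.trans ?_) (norm_nonneg _)
  refine mul_le_mul_of_nonneg_left (pow_le_pow_right₀ hb ?_) (norm_nonneg _)
  exact (Polynomial.card_roots' P).trans hD

abbrev UF : Filter ℕ := (hyperfilter ℕ : Filter ℕ)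

lemma UF_le : UF ≤ atTop := by
  rw [← Nat.cofinite_eq_atTop]; exact hyperfilter_le_cofinite

section
variable {E : Type*} [NormedAddCommGroup E] [NormedSpace ℂ E]

def bl (β : E → E) (b c : E) (j : ℕ) (y : E) : E := (j : ℂ) • (β (b + (j : ℂ)⁻¹ • y) - c)

lemma ulim [FiniteDimensional ℂ E] (u : ℕ → E) (R : ℝ) (h : ∀ᶠ j in UF, ‖u j‖ ≤ R) : ∃ x, Tendsto u UF (𝓝 x) := by
  have : ProperSpace E := FiniteDimensional.proper ℂ E
  obtain ⟨x, -, hx⟩ := (isCompact_closedBall (0:E) R).ultrafilter_le_nhds ((hyperfilter ℕ).map u) (by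
    rw [Ultrafilter.coe_map, le_principal_iff, mem_map]
    filter_upwards [h] with j hj
    simpa using hj)
  exact ⟨x, hx⟩

lemma inv_tendsto : Tendsto (fun j : ℕ => (j : ℂ)⁻¹) UF (𝓝 0) :=
  (tendsto_inv_atTop_nhds_zero_nat (𝕜 := ℂ)).mono_left UF_le

lemma UF_ne : ∀ᶠ j : ℕ in UF, (j : ℂ) ≠ 0 := by
  filter_upwards [UF_le (eventually_gt_atTop 0)] with j hj
  exact_mod_cast hj.ne'

lemma ev_dom (b : E) (r : ℝ) (hr : 0 < r) (u : ℕ → E) (y : E) (hu : Tendsto u UF (𝓝 y)) :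
    ∀ᶠ j : ℕ in UF, b + (j : ℂ)⁻¹ • u j ∈ Metric.ball b r := by
  have : Tendsto (fun j : ℕ => b + (j : ℂ)⁻¹ • u j) UF (𝓝 (b + (0:ℂ) • y)) :=
    tendsto_const_nhds.add (inv_tendsto.smul hu)
  rw [zero_smul, add_zero] at this
  exact this (Metric.ball_mem_nhds b hr)

lemma bl_lip (β : E → E) (b c : E) (K : NNReal) (r : ℝ)
    (hβ : LipschitzOnWith K β (Metric.ball b r)) (j : ℕ) (hj : (j : ℂ) ≠ 0) (y z : E)
    (hy : b + (j : ℂ)⁻¹ • y ∈ Metric.ball b r) (hz : b + (j : ℂ)⁻¹ • z ∈ Metric.ball b r) :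
    ‖bl β b c j y - bl β b c j z‖ ≤ K * ‖y - z‖ := by
  have h1 := hβ.dist_le_mul _ hy _ hz
  rw [dist_eq_norm, dist_eq_norm, add_sub_add_left_eq_sub, ← smul_sub, norm_smul, norm_inv] at h1
  have h2 : bl β b c j y - bl β b c j z = (j:ℂ) • (β (b + (j : ℂ)⁻¹ • y) - β (b + (j : ℂ)⁻¹ • z)) := by
    simp only [bl, ← smul_sub, sub_sub_sub_cancel_right]
  rw [h2, norm_smul]
  have h3 : 0 < ‖(j:ℂ)‖ := norm_pos_iff.2 hj
  calc _ ≤ ‖(j:ℂ)‖ * (K * (‖(j:ℂ)‖⁻¹ * ‖y - z‖)) := by gcongr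
    _ = _ := by field_simp

lemma blow [FiniteDimensional ℂ E] (β : E → E) (b c : E) (K : NNReal) (r : ℝ) (hr : 0 < r)
    (hβ : LipschitzOnWith K β (Metric.ball b r)) (hb : β b = c) :
    ∃ χ : E → E, Continuous χ ∧ ∀ y (u : ℕ → E), Tendsto u UF (𝓝 y) →
      Tendsto (fun j => bl β b c j (u j)) UF (𝓝 (χ y)) := by
  have h0 : ∀ j, bl β b c j 0 = 0 := fun j => by simp [bl, hb]
  have hd0 : ∀ j : ℕ, b + (j : ℂ)⁻¹ • (0:E) ∈ Metric.ball b r := fun j => by simpa using hr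
  have hex : ∀ y, ∃ x, Tendsto (fun j => bl β b c j y) UF (𝓝 x) := fun y => by
    refine ulim _ (K * ‖y‖) ?_
    filter_upwards [ev_dom b r hr _ y tendsto_const_nhds, UF_ne] with j hj hj0
    have := bl_lip β b c K r hβ j hj0 y 0 hj (hd0 j)
    simpa [h0] using this
  choose χ hχ using hex
  refine ⟨χ, ?_, fun y u hu => ?_⟩
  · refine (LipschitzWith.of_dist_le_mul (K := K) fun y z => ?_).continuous
    rw [dist_eq_norm, dist_eq_norm]
    refine le_of_tendsto ((hχ y).sub (hχ z)).norm ?_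
    filter_upwards [ev_dom b r hr _ y tendsto_const_nhds, ev_dom b r hr _ z tendsto_const_nhds, UF_ne]
      with j hj hj' hj0
    exact bl_lip β b c K r hβ j hj0 y z hj hj'
  · have h1 : Tendsto (fun j => bl β b c j (u j) - bl β b c j y) UF (𝓝 0) := by
      refine squeeze_zero_norm' (a := fun j => K * ‖u j - y‖) ?_ ?_
      · filter_upwards [ev_dom b r hr _ y tendsto_const_nhds, ev_dom b r hr _ y hu, UF_ne]
          with j hj hj' hj0
        exact bl_lip β b c K r hβ j hj0 _ _ hj' hj
      · have := ((hu.sub_const y).norm).const_mul (K:ℝ)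
        simpa using this
    simpa using h1.add (hχ y)

/-- local winding number -/
lemma wind_local (ℓ : E →L[ℂ] ℂ) (w : E) (hw : ℓ w = 1) (F : E → ℂ) (ρ : ℝ) (hρ : 0 < ρ)
    (hF : ContinuousOn F (Metric.ball 0 ρ)) (hF0 : ∀ y ∈ Metric.ball 0 ρ, ℓ y ≠ 0 → F y ≠ 0) :
    ∃ k : ℤ, ∀ y : ℝ → E, Continuous y → y (2 * Real.pi) = y 0 → (∀ t, y t ∈ Metric.ball 0 ρ) →
      ∀ σ : ℝ → ℂ, Continuous σ → (∀ t, exp (σ t) = ℓ (y t)) →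
      ∃ a : ℝ → ℂ, Continuous a ∧ (∀ t, exp (a t) = F (y t)) ∧
        ∀ l : ℤ, σ (2 * Real.pi) = σ 0 + l * (2 * Real.pi * I) →
          a (2 * Real.pi) = a 0 + (l * k : ℤ) * (2 * Real.pi * I) := by
  set η : E → E := fun y => ((ρ / (1 + ‖y‖) : ℝ) : ℂ) • y with hη
  have hpos : ∀ y : E, 0 < 1 + ‖y‖ := fun y => by positivity
  have hηc : Continuous η := by
    refine Continuous.smul (continuous_ofReal.comp ?_) continuous_id
    exact continuous_const.div (by fun_prop) fun y => (hpos y).ne'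
  have hηb : ∀ y, η y ∈ Metric.ball 0 ρ := fun y => by
    have := hpos y
    rw [mem_ball_zero_iff, hη, norm_smul, norm_real, Real.norm_of_nonneg (by positivity),
      div_mul_eq_mul_div, div_lt_iff₀ this]
    nlinarith
  have hηl : ∀ y, ℓ y ≠ 0 → ℓ (η y) ≠ 0 := fun y h => by
    rw [hη, map_smul, smul_eq_mul]
    refine mul_ne_zero ?_ h
    exact ofReal_ne_zero.2 (div_pos hρ (hpos y)).ne'
  have hGc : Continuous fun y => F (η y) := hF.comp_continuous hηc hηb
  obtain ⟨U, hUc, hU⟩ := log_lift (fun a : AA ℓ => F (η (cd ℓ w a))) (hGc.comp (cd_cont ℓ w))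
    (fun a => hF0 _ (hηb _) (hηl _ (ell_cd_ne ℓ w hw a)))
  obtain ⟨k, hk⟩ := period ℓ w (fun y => F (η y)) U hUc hU
  refine ⟨k, fun y hy hyp hyb σ hσ hσy => ?_⟩
  have hd : ∀ t, 0 < ρ - ‖y t‖ := fun t => by
    have := hyb t
    rw [mem_ball_zero_iff] at this
    linarith
  set x : ℝ → E := fun t => (((ρ - ‖y t‖)⁻¹ : ℝ) : ℂ) • y t with hx
  have hxc : Continuous x := by
    refine Continuous.smul (continuous_ofReal.comp ?_) hy
    exact (continuous_const.sub hy.norm).inv₀ fun t => (hd t).ne'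
  have hηx : ∀ t, η (x t) = y t := fun t => by
    have h1 := hd t
    have h2 : ‖x t‖ = ‖y t‖ / (ρ - ‖y t‖) := by
      rw [hx, norm_smul, norm_real, Real.norm_of_nonneg (by positivity)]; field_simp
    have h3 : ρ / (1 + ‖x t‖) * (ρ - ‖y t‖)⁻¹ = 1 := by
      rw [h2, show 1 + ‖y t‖ / (ρ - ‖y t‖) = ρ / (ρ - ‖y t‖) by field_simp; ring]
      field_simp
    simp only [hη]
    simp only [hx] at h3 ⊢
    rw [smul_smul, ← ofReal_mul, h3]
    simp
  have hxp : x (2 * Real.pi) = x 0 := by simp only [hx, hyp]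
  set τ : ℝ → ℂ := fun t => σ t + ((Real.log (ρ - ‖y t‖)⁻¹ : ℝ) : ℂ) with hτ
  have hτc : Continuous τ := by
    refine hσ.add (continuous_ofReal.comp (Continuous.log ?_ fun t => (inv_pos.2 (hd t)).ne'))
    exact (continuous_const.sub hy.norm).inv₀ fun t => (hd t).ne'
  have hτx : ∀ t, exp (τ t) = ℓ (x t) := fun t => by
    rw [hτ, exp_add, hσy, ← ofReal_exp, Real.exp_log (inv_pos.2 (hd t)), hx, map_smul, smul_eq_mul,
      mul_comm]
  refine ⟨fun t => U (τ t, pr ℓ w hw (x t)), hUc.comp (hτc.prodMk ((pr_cont ℓ w hw).comp hxc)),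
    fun t => ?_, fun l hl => ?_⟩
  · rw [hU, cd_pr ℓ w hw _ _ (hτx t), hηx]
  · have : τ (2 * Real.pi) = τ 0 + l * (2 * Real.pi * I) := by
      simp only [hτ, hl, hyp]; ring
    simp only [this, hxp, hk]

end
end Smith

end

noncomputable section
namespace Smith
open Complex Filter Topology

section
variable {E : Type*} [NormedAddCommGroup E] [NormedSpace ℂ E]

lemma bl_eq (α : E → E) (b c : E) (j : ℕ) (hj : (j : ℂ) ≠ 0) (u : E) :
    c + (j : ℂ)⁻¹ • bl α b c j u = α (b + (j : ℂ)⁻¹ • u) := by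
  rw [bl, smul_smul, inv_mul_cancel₀ hj, one_smul, add_sub_cancel]

lemma bl_inv (α β : E → E) (b c : E) (j : ℕ) (hj : (j : ℂ) ≠ 0) (u : E)
    (h : β (α (b + (j : ℂ)⁻¹ • u)) = b + (j : ℂ)⁻¹ • u) : bl β c b j (bl α b c j u) = u := by
  rw [bl, bl_eq α b c j hj, h, add_sub_cancel_left, smul_smul, mul_inv_cancel₀ hj, one_smul]

/-- small loop around a simple zero -/
lemma loop (F : ℂ → ℂ) (hF : Continuous F) (hF0 : F 0 = 0) (d : ℂ) (hd : d ≠ 0) (h : HasDerivAt F d 0)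
    (δ : ℝ) (hδ : 0 < δ) : ∃ ε : ℝ, 0 < ε ∧ ε < δ ∧ (∀ t : ℝ, F (ε * exp (t * I)) ≠ 0) ∧
      ∀ a : ℝ → ℂ, Continuous a → (∀ t, exp (a t) = F (ε * exp (t * I))) →
        a (2 * Real.pi) - a 0 = 2 * Real.pi * I := by
  have h1 := (hasDerivAt_iff_tendsto_slope_zero.1 h)
  simp only [zero_add, hF0, sub_zero, smul_eq_mul] at h1
  have h2 : ∀ᶠ t in 𝓝[≠] (0:ℂ), ‖t⁻¹ * F t - d‖ < ‖d‖ := by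
    have := (h1.sub_const d).norm
    rw [sub_self, norm_zero] at this
    exact this.eventually (gt_mem_nhds (norm_pos_iff.2 hd))
  rw [eventually_nhdsWithin_iff, Metric.eventually_nhds_iff] at h2
  obtain ⟨δ', hδ', h2⟩ := h2
  set ε := min δ δ' / 2 with hε
  have hmin : 0 < min δ δ' := lt_min hδ hδ'
  have hε0 : 0 < ε := half_pos hmin
  have hεm : ε < min δ δ' := half_lt_self hmin
  have hεc : (ε : ℂ) ≠ 0 := ofReal_ne_zero.2 hε0.ne'
  set z : ℝ → ℂ := fun t => ε * exp (t * I) with hz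
  have hzn : ∀ t, ‖z t‖ = ε := fun t => by
    rw [hz, norm_mul, norm_exp_ofReal_mul_I, mul_one, norm_real, Real.norm_of_nonneg hε0.le]
  have hz0 : ∀ t, z t ≠ 0 := fun t => by
    rw [← norm_ne_zero_iff, hzn]; exact hε0.ne'
  have hzc : Continuous z := by fun_prop
  have h3 : ∀ t, ‖(z t)⁻¹ * F (z t) - d‖ < ‖d‖ := fun t => h2 (by
    rw [dist_zero_right, hzn]; exact hεm.trans_le (min_le_right _ _)) (hz0 t)
  set q : ℝ → ℂ := fun t => (z t)⁻¹ * F (z t) / d with hq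
  have hq1 : ∀ t, ‖q t - 1‖ < 1 := fun t => by
    rw [hq, show (z t)⁻¹ * F (z t) / d - 1 = ((z t)⁻¹ * F (z t) - d) / d by field_simp, norm_div,
      div_lt_one (norm_pos_iff.2 hd)]
    exact h3 t
  have hFq : ∀ t, F (z t) = q t * (d * z t) := fun t => by
    have := hz0 t
    simp only [hq]; field_simp
  have hzp : z (2 * Real.pi) = z 0 := by
    simp only [hz]
    push_cast
    rw [exp_two_pi_mul_I, zero_mul, exp_zero]
  refine ⟨ε, hε0, hεm.trans_le (min_le_left _ _), fun t h0 => ?_, fun a ha hat => ?_⟩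
  · have := h3 t
    rw [show F (z t) = 0 from h0] at this
    simp at this
  · have := wind_eq a (fun t => log (d * ε) + t * I) q ha (by fun_prop)
      ((hzc.inv₀ hz0).mul (hF.comp hzc) |>.div_const d) (fun t => by
        rw [hat, exp_add, exp_log (mul_ne_zero hd hεc)]
        have := hFq t
        simp only [hz] at this ⊢
        rw [this]; ring) hq1 0 (2 * Real.pi) (by simp only [hq, hzp])
    rw [this]; push_cast; ring

theorem core [FiniteDimensional ℂ E] (ℓ : E →L[ℂ] ℂ) (w : E) (hw : ℓ w = 1) (f : E → ℂ)
    (hf : Continuous f) (p : E) (α β : E → E) (K : NNReal) (r : ℝ) (hr : 0 < r)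
    (hα : LipschitzOnWith K α (Metric.ball p r)) (hβ : LipschitzOnWith K β (Metric.ball 0 r))
    (hαp : α p = 0) (hβ0 : β 0 = p)
    (hβα : ∀ x ∈ Metric.ball p r, β (α x) = x) (hαβ : ∀ y ∈ Metric.ball 0 r, α (β y) = y)
    (hfα : ∀ x ∈ Metric.ball p r, f x = 0 ↔ ℓ (α x) = 0)
    (hfβ : ∀ y ∈ Metric.ball 0 r, f (β y) = 0 ↔ ℓ y = 0)
    (m : ℕ) (hm : 2 ≤ m) (Q : ℂ → E → ℂ) (hQc : Continuous fun z : ℂ × E => Q z.1 z.2)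
    (hQ : ∀ s x, f (p + s • x) = s ^ m * Q s x)
    (hh : ∀ (c : ℂ) x, Q 0 (c • x) = c ^ m * Q 0 x) (hne : ∃ x, Q 0 x ≠ 0) (D : ℕ)
    (hQD : ∀ s x v, ∃ P : Polynomial ℂ, P.natDegree ≤ D ∧ ∀ t : ℂ, Q s (x + t • v) = P.eval t)
    (hsm : ∀ ε > 0, ∃ x ∈ Metric.ball p ε, ∃ v, f x = 0 ∧
      ∃ d, d ≠ 0 ∧ HasDerivAt (fun t : ℂ => f (x + t • v)) d 0) : False := by
  obtain ⟨Ψ, hΨc, hΨ⟩ := blow α p 0 K r hr hα hαp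
  obtain ⟨χ, hχc, hχ⟩ := blow β 0 p K r hr hβ hβ0
  have hχΨ : ∀ x, χ (Ψ x) = x := fun x => by
    refine tendsto_nhds_unique (hχ _ _ (hΨ x _ tendsto_const_nhds)) ?_
    refine (tendsto_const_nhds (x := x)).congr' ?_
    filter_upwards [UF_ne, ev_dom p r hr _ x tendsto_const_nhds] with j hj hd
    exact (bl_inv α β p 0 j hj x (hβα _ hd)).symm
  have hΨχ : ∀ x, Ψ (χ x) = x := fun x => by
    refine tendsto_nhds_unique (hΨ _ _ (hχ x _ tendsto_const_nhds)) ?_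
    refine (tendsto_const_nhds (x := x)).congr' ?_
    filter_upwards [UF_ne, ev_dom 0 r hr _ x tendsto_const_nhds] with j hj hd
    exact (bl_inv β α 0 p j hj x (hαβ _ hd)).symm
  have hQlim : ∀ (u : ℕ → E) x, Tendsto u UF (𝓝 x) →
      Tendsto (fun j : ℕ => Q (j:ℂ)⁻¹ (u j)) UF (𝓝 (Q 0 x)) := fun u x hu =>
    (hQc.tendsto (0, x)).comp (inv_tendsto.prodMk_nhds hu)
  have hz : ∀ x, Q 0 x = 0 ↔ ℓ (Ψ x) = 0 := by
    intro x
    constructor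
    · intro h0
      by_contra hc
      set e := ‖ℓ (Ψ x)‖ / 2 with he
      have he0 : 0 < e := half_pos (norm_pos_iff.2 hc)
      set C : ℝ := ‖ℓ‖ * K + 1 with hC
      have hC0 : 0 < C := by positivity
      set s := e / C with hs
      have hs0 : 0 < s := by positivity
      have hev : ∀ᶠ j : ℕ in UF, ∀ x', ‖x' - x‖ < s → Q (j:ℂ)⁻¹ x' ≠ 0 := by
        have h1 : ∀ᶠ j in UF, e < ‖ℓ (bl α p 0 j x)‖ := by
          have := ((ℓ.continuous.tendsto _).comp (hΨ x _ tendsto_const_nhds)).norm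
          exact this.eventually (lt_mem_nhds (half_lt_self (norm_pos_iff.2 hc)))
        have h2 : ∀ᶠ j : ℕ in UF, ∀ x', ‖x' - x‖ < s → p + (j:ℂ)⁻¹ • x' ∈ Metric.ball p r := by
          have h3 : Tendsto (fun j : ℕ => ‖(j:ℂ)⁻¹‖ * (‖x‖ + s)) UF (𝓝 0) := by
            have := (inv_tendsto.norm).mul_const (‖x‖ + s)
            simpa using this
          filter_upwards [h3.eventually (gt_mem_nhds hr)] with j hj x' hx'
          rw [Metric.mem_ball, dist_eq_norm, add_sub_cancel_left, norm_smul]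
          refine lt_of_le_of_lt ?_ hj
          gcongr
          have := norm_add_le x (x' - x)
          rw [add_sub_cancel] at this
          linarith
        filter_upwards [h1, h2, UF_ne] with j hj1 hj2 hj0 x' hx' hQ0
        have h3 := hj2 x' hx'
        have h4 := hj2 x (by simpa using hs0)
        have h5 : f (p + (j:ℂ)⁻¹ • x') = 0 := by rw [hQ, hQ0, mul_zero]
        have h6 := (hfα _ h3).1 h5
        have h7 : ℓ (bl α p 0 j x') = 0 := by rw [bl, sub_zero, map_smul, h6, smul_zero]
        have h8 := bl_lip α p 0 K r hα j hj0 x x' h4 h3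
        have h9 := ℓ.le_opNorm (bl α p 0 j x - bl α p 0 j x')
        rw [map_sub, h7, sub_zero] at h9
        rw [norm_sub_rev] at hx'
        have h10 : ‖ℓ‖ * ‖bl α p 0 j x - bl α p 0 j x'‖ ≤ ‖ℓ‖ * (K * ‖x - x'‖) := by gcongr
        have h11 : ‖ℓ‖ * (K * ‖x - x'‖) ≤ C * ‖x - x'‖ := by
          rw [hC]; nlinarith [norm_nonneg (x - x')]
        have h12 : C * ‖x - x'‖ < C * s := by gcongr
        have h13 : C * s = e := by rw [hs]; field_simp
        linarith
      obtain ⟨x₁, hx₁⟩ := hne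
      apply hx₁
      rw [← norm_le_zero_iff]
      set v := x₁ - x with hv
      set ρ := s / (‖v‖ + 1) with hρ
      have hρ0 : 0 < ρ := by positivity
      have hb : ∀ᶠ j : ℕ in UF, ‖Q (j:ℂ)⁻¹ x₁‖ ≤ ‖Q (j:ℂ)⁻¹ x‖ * (1 + ‖(1:ℂ)‖ / ρ) ^ D := by
        filter_upwards [hev] with j hj
        obtain ⟨P, hPD, hP⟩ := hQD (j:ℂ)⁻¹ x v
        have := poly_bound P D hPD ρ hρ0 (fun t ht => by
          rw [← hP]
          refine hj _ ?_
          rw [add_sub_cancel_left, norm_smul]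
          rw [hρ, lt_div_iff₀ (by positivity)] at ht
          nlinarith [norm_nonneg t]) 1
        rw [← hP, ← hP] at this
        simpa [hv] using this
      have := le_of_tendsto_of_tendsto (hQlim _ x₁ tendsto_const_nhds).norm
        ((hQlim _ x tendsto_const_nhds).norm.mul_const _) hb
      rwa [h0, norm_zero, zero_mul] at this
    · intro h0
      have h1 := hχ (Ψ x) _ tendsto_const_nhds
      rw [hχΨ] at h1
      refine tendsto_nhds_unique (hQlim _ x h1) ?_
      refine (tendsto_const_nhds (x := (0:ℂ))).congr' ?_
      filter_upwards [UF_ne, ev_dom 0 r hr _ (Ψ x) tendsto_const_nhds] with j hj hd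
      have h2 : f (p + (j:ℂ)⁻¹ • bl β 0 p j (Ψ x)) = 0 := by
        rw [bl_eq β 0 p j hj, hfβ _ hd]; simp [h0]
      rw [hQ] at h2
      rcases mul_eq_zero.1 h2 with h3 | h3
      · exact absurd h3 (pow_ne_zero _ (inv_ne_zero hj))
      · exact h3.symm
  have hQ0c : Continuous (Q 0) := hQc.comp (Continuous.prodMk_right 0)
  have hlift0 : ∀ y, ℓ y ≠ 0 → Q 0 (χ y) ≠ 0 := fun y hy h0 => by
    rw [hz, hΨχ] at h0; exact hy h0
  obtain ⟨U, hUc, hU⟩ := log_lift (fun a : AA ℓ => Q 0 (χ (cd ℓ w a)))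
    (hQ0c.comp (hχc.comp (cd_cont ℓ w))) (fun a => hlift0 _ (ell_cd_ne ℓ w hw a))
  obtain ⟨k, hk⟩ := period ℓ w (fun y => Q 0 (χ y)) U hUc hU
  obtain ⟨k', hk'⟩ := wind_local ℓ w hw (fun y => f (β y)) r hr (hf.comp_continuousOn hβ.continuousOn)
    (fun y hy hl h0 => hl ((hfβ y hy).1 h0))
  set W : ℝ → E := fun t => exp (t * I) • w with hW
  have hWc : Continuous W := by fun_prop
  have hWl : ∀ t, ℓ (W t) = exp (t * I) := fun t => by simp [hW, hw]
  have hWp : W (2 * Real.pi) = W 0 := by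
    simp only [hW]
    push_cast
    rw [exp_two_pi_mul_I, zero_mul, exp_zero]
  have hWn : ∀ t, ‖W t‖ = ‖w‖ := fun t => by
    rw [hW, norm_smul, norm_exp_ofReal_mul_I, one_mul]
  -- comparison of the two winding numbers
  have hkk : k' = k := by
    have hclose : ∃ j : ℕ, (j : ℂ) ≠ 0 ∧ (∀ t, (j:ℂ)⁻¹ • W t ∈ Metric.ball (0:E) r) ∧
        ∀ t, ‖(j:ℂ) ^ m * f (β ((j:ℂ)⁻¹ • W t)) / Q 0 (χ (W t)) - 1‖ < 1 := by
      have hA : ∀ᶠ j : ℕ in UF, ∀ t, ‖(j:ℂ) ^ m * f (β ((j:ℂ)⁻¹ • W t)) / Q 0 (χ (W t)) - 1‖ < 1 := by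
        by_contra hcon
        have hcon' := (Ultrafilter.eventually_not (f := hyperfilter ℕ)).2 hcon
        simp only [not_forall, not_lt] at hcon'
        have : ∃ T : ℕ → ℝ, ∀ᶠ j : ℕ in UF, 1 ≤ ‖(j:ℂ) ^ m * f (β ((j:ℂ)⁻¹ • W (T j))) / Q 0 (χ (W (T j))) - 1‖ :=
          hcon'.choice
        obtain ⟨T, hT⟩ := this
        obtain ⟨u, hu⟩ := ulim (fun j => W (T j)) ‖w‖ (Eventually.of_forall fun j => (hWn _).le)
        have hlu : ℓ u ≠ 0 := by
          have h1 := ((ℓ.continuous.tendsto _).comp hu).norm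
          have h2 : Tendsto (fun _ : ℕ => (1:ℝ)) UF (𝓝 ‖ℓ u‖) := by
            refine h1.congr fun j => ?_
            simp only [Function.comp, hWl, norm_exp_ofReal_mul_I]
          have h3 := tendsto_nhds_unique h2 tendsto_const_nhds
          rw [← norm_ne_zero_iff, h3]; exact one_ne_zero
        have h1 : Tendsto (fun j : ℕ => Q (j:ℂ)⁻¹ (bl β 0 p j (W (T j))) / Q 0 (χ (W (T j))) - 1) UF (𝓝 0) := by
          have := ((hQlim _ _ (hχ u _ hu)).div (((hQ0c.comp hχc).tendsto u).comp hu) (hlift0 u hlu)).sub_const 1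
          simpa [Function.comp_def, div_self (hlift0 u hlu)] using this
        have h2 := h1.norm
        rw [norm_zero] at h2
        obtain ⟨j, hj1, hj2, hj0⟩ := (hT.and ((h2.eventually (gt_mem_nhds one_pos)).and UF_ne)).exists
        have h3 := hQ (j:ℂ)⁻¹ (bl β 0 p j (W (T j)))
        rw [bl_eq β 0 p j hj0, zero_add] at h3
        have h4 : (j:ℂ) ^ m * f (β ((j:ℂ)⁻¹ • W (T j))) = Q (j:ℂ)⁻¹ (bl β 0 p j (W (T j))) := by
          rw [h3, ← mul_assoc, ← mul_pow, mul_inv_cancel₀ hj0, one_pow, one_mul]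
        rw [h4] at hj1
        linarith
      have hB : ∀ᶠ j : ℕ in UF, ∀ t, (j:ℂ)⁻¹ • W t ∈ Metric.ball (0:E) r := by
        have h3 : Tendsto (fun j : ℕ => ‖(j:ℂ)⁻¹‖ * ‖w‖) UF (𝓝 0) := by
          have := (inv_tendsto.norm).mul_const ‖w‖
          simpa using this
        filter_upwards [h3.eventually (gt_mem_nhds hr)] with j hj t
        rw [mem_ball_zero_iff, norm_smul, hWn]; exact hj
      obtain ⟨j, h1, h2, h3⟩ := (UF_ne.and (hB.and hA)).exists
      exact ⟨j, h1, h2, h3⟩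
    obtain ⟨j, hj0, hjb, hjq⟩ := hclose
    obtain ⟨a, hac, ha, hal⟩ := hk' (fun t => (j:ℂ)⁻¹ • W t) (by fun_prop) (by simp only [hWp]) hjb
      (fun t => log (j:ℂ)⁻¹ + t * I) (by fun_prop) (fun t => by
        rw [exp_add, exp_log (inv_ne_zero hj0), map_smul, hWl, smul_eq_mul])
    have hal1 := hal 1 (by push_cast; simp)
    have hb : ∀ t : ℝ, exp (U (t * I, 0)) = Q 0 (χ (W t)) := fun t => by
      rw [hU]; simp [cd, hW]
    have hbk := hk 1 0 0
    have := wind_eq (fun t => a t + m * log j) (fun t => U (t * I, 0))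
      (fun t => (j:ℂ) ^ m * f (β ((j:ℂ)⁻¹ • W t)) / Q 0 (χ (W t))) (by fun_prop) (by fun_prop)
      (by
        refine Continuous.div ?_ (hQ0c.comp (hχc.comp hWc)) fun t => hlift0 _ (by rw [hWl]; exact exp_ne_zero _)
        refine continuous_const.mul (hf.comp ?_)
        exact hβ.continuousOn.comp_continuous (by fun_prop) hjb)
      (fun t => by
        have h1 : Q 0 (χ (W t)) ≠ 0 := hlift0 _ (by rw [hWl]; exact exp_ne_zero _)
        rw [hb, exp_add, ha, exp_nat_mul, exp_log hj0]
        field_simp) hjq 0 (2 * Real.pi) (by simp only [hWp])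
    simp only [add_sub_add_right_eq_sub, hal1] at this
    push_cast at this hbk
    simp only [one_mul, zero_add, zero_mul] at this hbk
    rw [hbk] at this
    have h3 : ((k':ℂ) - k) * (2 * Real.pi * I) = 0 := by linear_combination this
    rw [mul_eq_zero, or_iff_left two_pi_I_ne_zero, sub_eq_zero] at h3
    exact_mod_cast h3
  -- a loop around a simple point
  have hkl : ∃ l : ℤ, k' * l = 1 := by
    have hαc : ContinuousAt α p := hα.continuousOn.continuousAt (Metric.ball_mem_nhds p hr)
    have hn : ∀ᶠ x in 𝓝 p, x ∈ Metric.ball p r ∧ α x ∈ Metric.ball 0 r := by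
      refine Eventually.and (Metric.ball_mem_nhds p hr) ?_
      refine hαc.eventually ?_
      rw [hαp]
      exact Metric.ball_mem_nhds 0 hr
    obtain ⟨ε, hε, hεb⟩ := Metric.eventually_nhds_iff.1 hn
    obtain ⟨x, hx, v, hfx, d, hd, hder⟩ := hsm ε hε
    have hcl : Continuous fun t : ℂ => x + t • v := by fun_prop
    have hopen : ∀ᶠ t in 𝓝 (0:ℂ), x + t • v ∈ Metric.ball p ε := by
      refine hcl.continuousAt.eventually ?_
      simp only [zero_smul, add_zero]
      exact Metric.isOpen_ball.mem_nhds hx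
    obtain ⟨δ, hδ, hδb⟩ := Metric.eventually_nhds_iff.1 hopen
    obtain ⟨e, he0, heδ, hne0, hloop⟩ := loop (fun t => f (x + t • v)) (hf.comp hcl) (by simpa using hfx) d hd hder δ hδ
    set γ : ℝ → E := fun t => x + ((e:ℂ) * exp (t * I)) • v with hγ
    have hγb : ∀ t, γ t ∈ Metric.ball p r ∧ α (γ t) ∈ Metric.ball 0 r := fun t => by
      refine hεb (hδb ?_)
      rw [dist_zero_right, norm_mul, norm_exp_ofReal_mul_I, mul_one, norm_real, Real.norm_of_nonneg he0.le]
      exact heδ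
    have hγc : Continuous γ := by fun_prop
    have hγp : γ (2 * Real.pi) = γ 0 := by
      simp only [hγ]
      push_cast
      rw [exp_two_pi_mul_I, zero_mul, exp_zero]
    have hyc : Continuous fun t => α (γ t) := hα.continuousOn.comp_continuous hγc fun t => (hγb t).1
    have hy0 : ∀ t, ℓ (α (γ t)) ≠ 0 := fun t h0 => hne0 t ((hfα _ (hγb t).1).2 h0)
    obtain ⟨σ, hσc, hσ⟩ := log_lift (fun t => ℓ (α (γ t))) (ℓ.continuous.comp hyc) hy0
    obtain ⟨a, hac, ha, hal⟩ := hk' (fun t => α (γ t)) hyc (by simp only [hγp]) (fun t => (hγb t).2) σ hσc hσ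
    obtain ⟨l, hl⟩ := exp_eq_exp_iff_exists_int.1 (show exp (σ (2 * Real.pi)) = exp (σ 0) by rw [hσ, hσ, hγp])
    have h1 := hloop a hac (fun t => by rw [ha, hβα _ (hγb t).1])
    rw [hal l hl, add_sub_cancel_left] at h1
    refine ⟨l, ?_⟩
    have h2 : ((l * k' : ℤ) : ℂ) = 1 := mul_right_cancel₀ two_pi_I_ne_zero (by rw [h1, one_mul])
    rw [mul_comm]
    exact_mod_cast h2
  obtain ⟨l, hl⟩ := hkl
  rw [hkk] at hl
  exact endgame ℓ w hw χ Ψ hχc hΨc hχΨ hΨχ (Q 0) m hm hh hz U hUc hU k l hl hk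

end
end Smith

end

noncomputable section
namespace Smith
open Complex Filter Topology

lemma chart {E : Type*} [NormedAddCommGroup E] [NormedSpace ℂ E] [CompleteSpace E]
    (ℓ : E →L[ℂ] ℂ) (w : E) (hw : ℓ w = 1) (f g : E → ℂ) (U U' : Set E) (φ ψ : E → E) (K : NNReal)
    (hU : IsOpen U) (hU' : IsOpen U') (hmφ : Set.MapsTo φ U U') (hmψ : Set.MapsTo ψ U' U)
    (hl : Set.LeftInvOn ψ φ U) (hr : Set.RightInvOn ψ φ U') (hφ : LipschitzOnWith K φ U)
    (hψ : LipschitzOnWith K ψ U') (hfg : ∀ x ∈ U, f x = 0 ↔ g (φ x) = 0)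
    (p : E) (hp : p ∈ U) (hgp : g (φ p) = 0) (hg : HasStrictFDerivAt g ℓ (φ p)) :
    ∃ (α β : E → E) (K : NNReal) (r : ℝ), 0 < r ∧ LipschitzOnWith K α (Metric.ball p r) ∧
      LipschitzOnWith K β (Metric.ball 0 r) ∧ α p = 0 ∧ β 0 = p ∧
      (∀ x ∈ Metric.ball p r, β (α x) = x) ∧ (∀ y ∈ Metric.ball 0 r, α (β y) = y) ∧
      (∀ x ∈ Metric.ball p r, f x = 0 ↔ ℓ (α x) = 0) ∧
      (∀ y ∈ Metric.ball 0 r, f (β y) = 0 ↔ ℓ y = 0) := by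
  set q := φ p with hq
  set G : E → E := fun y => (y - q) + (g y - ℓ (y - q)) • w with hG
  have hGq : G q = 0 := by simp [hG, hgp]
  have hℓG : ∀ y, ℓ (G y) = g y := fun y => by simp [hG, hw]
  have hGd : HasStrictFDerivAt G ((ContinuousLinearEquiv.refl ℂ E : E ≃L[ℂ] E) : E →L[ℂ] E) q := by
    have h1 : HasStrictFDerivAt (fun y : E => y - q) (ContinuousLinearMap.id ℂ E) q :=
      (hasStrictFDerivAt_id q).sub_const q
    have h2 : HasStrictFDerivAt (fun y => ℓ (y - q)) (ℓ.comp (ContinuousLinearMap.id ℂ E)) q :=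
      ℓ.hasStrictFDerivAt.comp q h1
    have h3 := h1.add ((hg.sub h2).smul_const w)
    convert h3 using 1
    · rfl
    · rw [ContinuousLinearMap.comp_id, sub_self]
      ext x
      simp
  set Gi := hGd.localInverse G _ q with hGi
  have hGi0 : Gi 0 = q := by rw [← hGq]; exact hGd.localInverse_apply_image
  have hGid := hGd.to_localInverse
  rw [hGq] at hGid
  have hleft := hGd.eventually_left_inverse
  have hright := hGd.eventually_right_inverse
  rw [hGq] at hright
  obtain ⟨K1, s1, hs1, hK1⟩ := hGd.exists_lipschitzOnWith
  obtain ⟨K2, s2, hs2, hK2⟩ := hGid.exists_lipschitzOnWith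
  have hφc : ContinuousAt φ p := hφ.continuousOn.continuousAt (hU.mem_nhds hp)
  have hGic : ContinuousAt Gi 0 := hGid.continuousAt
  have hnp : ∀ᶠ x in 𝓝 p, x ∈ U ∧ φ x ∈ s1 ∧ Gi (G (φ x)) = φ x :=
    Eventually.and (hU.mem_nhds hp) (hφc.eventually (Eventually.and hs1 hleft))
  have hn0 : ∀ᶠ y in 𝓝 0, (y ∈ s2 ∧ G (Gi y) = y) ∧ Gi y ∈ U' := by
    refine Eventually.and (Eventually.and hs2 hright) (hGic.eventually ?_)
    rw [hGi0]
    exact hU'.mem_nhds (hmφ hp)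
  obtain ⟨r1, hr1, h1⟩ := Metric.eventually_nhds_iff.1 hnp
  obtain ⟨r2, hr2, h2⟩ := Metric.eventually_nhds_iff.1 hn0
  have h1' : ∀ x ∈ Metric.ball p (min r1 r2), x ∈ U ∧ φ x ∈ s1 ∧ Gi (G (φ x)) = φ x :=
    fun x hx => h1 (lt_of_lt_of_le hx (min_le_left _ _))
  have h2' : ∀ y ∈ Metric.ball (0:E) (min r1 r2), (y ∈ s2 ∧ G (Gi y) = y) ∧ Gi y ∈ U' :=
    fun y hy => h2 (lt_of_lt_of_le hy (min_le_right _ _))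
  have hαβ : ∀ y ∈ Metric.ball (0:E) (min r1 r2), G (φ (ψ (Gi y))) = y := fun y hy => by
    rw [hr (h2' y hy).2, (h2' y hy).1.2]
  refine ⟨fun x => G (φ x), fun y => ψ (Gi y), max (K1 * K) (K * K2), min r1 r2, lt_min hr1 hr2,
    ?_, ?_, hGq, ?_, ?_, hαβ, ?_, ?_⟩
  · refine LipschitzOnWith.weaken ?_ (le_max_left _ _)
    exact hK1.comp (hφ.mono fun x hx => (h1' x hx).1) fun x hx => (h1' x hx).2.1
  · refine LipschitzOnWith.weaken ?_ (le_max_right _ _)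
    exact hψ.comp (hK2.mono fun y hy => (h2' y hy).1.1) fun y hy => (h2' y hy).2
  · simp only [hGi0]; exact hl hp
  · intro x hx
    simp only [(h1' x hx).2.2]; exact hl (h1' x hx).1
  · intro x hx
    rw [hfg x (h1' x hx).1, hℓG]
  · intro y hy
    rw [hfg _ (hmψ (h2' y hy).2), ← hℓG, hαβ y hy]

end Smith

end

noncomputable section
namespace Smith
open Filter Topology

section
variable {n : ℕ}

lemma mv_deriv (g : MvPolynomial (Fin n) ℂ) (q : EuclideanSpace ℂ (Fin n)) :
    HasStrictFDerivAt (fun x : EuclideanSpace ℂ (Fin n) => MvPolynomial.eval (x : Fin n → ℂ) g)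
      (∑ i, (MvPolynomial.eval (q : Fin n → ℂ) (MvPolynomial.pderiv i g)) •
        (EuclideanSpace.proj i : EuclideanSpace ℂ (Fin n) →L[ℂ] ℂ)) q := by
  induction g using MvPolynomial.induction_on with
  | C a =>
    refine ((hasStrictFDerivAt_const (𝕜 := ℂ) a q).congr_fderiv ?_).congr_of_eventuallyEq
      (Eventually.of_forall fun x => by simp)
    ext x
    simp
  | add a b ha hb =>
    have := ha.add hb
    refine (this.congr_fderiv ?_).congr_of_eventuallyEq (Eventually.of_forall fun x => by simp)
    ext x
    simp [add_mul, Finset.sum_add_distrib]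
  | mul_X a j ha =>
    have h2 : HasStrictFDerivAt (fun x : EuclideanSpace ℂ (Fin n) => x j)
      (EuclideanSpace.proj j : EuclideanSpace ℂ (Fin n) →L[ℂ] ℂ) q :=
      (EuclideanSpace.proj j : EuclideanSpace ℂ (Fin n) →L[ℂ] ℂ).hasStrictFDerivAt
    have := ha.mul h2
    refine (this.congr_fderiv ?_).congr_of_eventuallyEq (Eventually.of_forall fun x => by simp)
    ext x
    simp [MvPolynomial.pderiv_X, Pi.single_apply, add_mul, Finset.sum_add_distrib, Finset.mul_sum]
    congr 1
    · rw [Finset.sum_eq_single j]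
      · simp
      · intro b _ hb
        simp [hb.symm]
      · simp
    · refine Finset.sum_congr rfl fun i _ => ?_
      ring

lemma mv_cont (g : MvPolynomial (Fin n) ℂ) :
    Continuous (fun x : EuclideanSpace ℂ (Fin n) => MvPolynomial.eval (x : Fin n → ℂ) g) :=
  continuous_iff_continuousAt.2 fun q => (mv_deriv g q).continuousAt

lemma mv_line (f : MvPolynomial (Fin n) ℂ) (x v : Fin n → ℂ) :
    ∃ P : Polynomial ℂ, P.natDegree ≤ f.totalDegree ∧
      ∀ t : ℂ, MvPolynomial.eval (x + t • v) f = P.eval t := by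
  refine ⟨∑ d ∈ f.support, Polynomial.C (f.coeff d) *
    ∏ i, (Polynomial.C (v i) * Polynomial.X + Polynomial.C (x i)) ^ d i, ?_, ?_⟩
  · refine Polynomial.natDegree_sum_le_of_forall_le _ _ fun d hd => ?_
    refine (Polynomial.natDegree_C_mul_le _ _).trans ?_
    refine (Polynomial.natDegree_prod_le _ _).trans ?_
    refine le_trans ?_ (MvPolynomial.le_totalDegree hd)
    rw [Finsupp.sum_fintype _ _ (by simp)]
    refine Finset.sum_le_sum fun i _ => ?_
    refine Polynomial.natDegree_pow_le.trans ?_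
    have := Polynomial.natDegree_linear_le (a := v i) (b := x i)
    nlinarith
  · intro t
    rw [MvPolynomial.eval_eq', Polynomial.eval_finsetSum]
    refine Finset.sum_congr rfl fun d _ => ?_
    rw [Polynomial.eval_mul, Polynomial.eval_prod, Polynomial.eval_C]
    congr 1
    refine Finset.prod_congr rfl fun i _ => ?_
    simp
    ring

lemma mv_homog {f : MvPolynomial (Fin n) ℂ} {d : ℕ} (hf : f.IsHomogeneous d) (c : ℂ)
    (x : Fin n → ℂ) : MvPolynomial.eval (c • x) f = c ^ d * MvPolynomial.eval x f := by
  rw [MvPolynomial.eval_eq', MvPolynomial.eval_eq', Finset.mul_sum]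
  refine Finset.sum_congr rfl fun e he => ?_
  have h := hf.degree_eq_sum_deg_support he
  have h' : d = ∑ i, e i := by
    rw [h]; exact Finset.sum_subset (Finset.subset_univ _) fun i _ hi => by simpa using hi
  simp only [Pi.smul_apply, smul_eq_mul, mul_pow, Finset.prod_mul_distrib]
  rw [Finset.prod_pow_eq_pow_sum, ← h']
  ring

lemma mv_blow (f : MvPolynomial (Fin n) ℂ) (hf : f ≠ 0) (p : EuclideanSpace ℂ (Fin n))
    (hfp : MvPolynomial.eval (p : Fin n → ℂ) f = 0)
    (hd : ∀ i, MvPolynomial.eval (p : Fin n → ℂ) (MvPolynomial.pderiv i f) = 0) :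
    ∃ (m : ℕ) (Q : ℂ → EuclideanSpace ℂ (Fin n) → ℂ) (D : ℕ), 2 ≤ m ∧
      (Continuous fun z : ℂ × EuclideanSpace ℂ (Fin n) => Q z.1 z.2) ∧
      (∀ (s : ℂ) (x : EuclideanSpace ℂ (Fin n)),
        MvPolynomial.eval (p + s • x : EuclideanSpace ℂ (Fin n)) f = s ^ m * Q s x) ∧
      (∀ (c : ℂ) x, Q 0 (c • x) = c ^ m * Q 0 x) ∧ (∃ x, Q 0 x ≠ 0) ∧
      (∀ s x v, ∃ P : Polynomial ℂ, P.natDegree ≤ D ∧ ∀ t : ℂ, Q s (x + t • v) = P.eval t) := by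
  classical
  set F : MvPolynomial (Fin n) ℂ :=
    MvPolynomial.aeval (fun i => MvPolynomial.X i + MvPolynomial.C (p i)) f with hF
  have hev : ∀ x : Fin n → ℂ, MvPolynomial.eval x F = MvPolynomial.eval (x + (p : Fin n → ℂ)) f := by
    intro x
    rw [hF]
    clear hF F hd hfp hf
    induction f using MvPolynomial.induction_on with
    | C a => simp
    | add a b ha hb => rw [map_add, map_add, ha, hb, map_add]
    | mul_X a j ha => rw [map_mul, map_mul, ha, map_mul]; simp
  have hF0 : F ≠ 0 := by
    intro h
    apply hf
    apply MvPolynomial.funext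
    intro x
    have := hev (x - (p : Fin n → ℂ))
    rw [h] at this
    simpa using this.symm
  have hex : ∃ d, MvPolynomial.homogeneousComponent d F ≠ 0 := by
    by_contra! h
    apply hF0
    rw [← MvPolynomial.sum_homogeneousComponent F]
    simp [h]
  set m := Nat.find hex with hm
  have hm1 : MvPolynomial.homogeneousComponent m F ≠ 0 := Nat.find_spec hex
  have hm2 : ∀ d < m, MvPolynomial.homogeneousComponent d F = 0 := fun d hd => by
    by_contra h; exact Nat.find_min hex hd h
  set N := F.totalDegree with hN
  have hmN : m ≤ N := by
    by_contra! h
    exact hm1 (MvPolynomial.homogeneousComponent_eq_zero _ _ h)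
  let G : ℂ → MvPolynomial (Fin n) ℂ := fun s => ∑ d ∈ Finset.range (N + 1),
    MvPolynomial.C (s ^ (d - m)) * MvPolynomial.homogeneousComponent d F
  let Q : ℂ → EuclideanSpace ℂ (Fin n) → ℂ := fun s x => MvPolynomial.eval (x : Fin n → ℂ) (G s)
  have hQe : ∀ s x, Q s x = ∑ d ∈ Finset.range (N + 1),
    s ^ (d - m) * MvPolynomial.eval (x : Fin n → ℂ) (MvPolynomial.homogeneousComponent d F) := by
    intro s x
    simp [Q, G]
  have hG0 : G 0 = MvPolynomial.homogeneousComponent m F := by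
    simp only [G]
    rw [Finset.sum_eq_single m]
    · simp
    · intro d _ hdm
      rcases lt_or_gt_of_ne hdm with h | h
      · simp [hm2 d h]
      · rw [zero_pow (by omega)]; simp
    · intro h; simp at h; omega
  have hQ : ∀ (s : ℂ) (x : EuclideanSpace ℂ (Fin n)),
        MvPolynomial.eval (p + s • x : EuclideanSpace ℂ (Fin n)) f = s ^ m * Q s x := by
    intro s x
    have h1 := hev (s • (x : Fin n → ℂ))
    have h2 : (s • (x : Fin n → ℂ) + (p : Fin n → ℂ)) = (p + s • x : EuclideanSpace ℂ (Fin n)) := by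
      ext i; simp [add_comm]
    rw [h2] at h1
    rw [← h1, hQe, ← MvPolynomial.sum_homogeneousComponent F, map_sum, Finset.mul_sum,
      MvPolynomial.sum_homogeneousComponent F]
    refine Finset.sum_congr rfl fun d _ => ?_
    by_cases hdm : d < m
    · simp [hm2 d hdm]
    · rw [mv_homog (MvPolynomial.homogeneousComponent_isHomogeneous d F), ← mul_assoc, ← pow_add]
      congr 2; omega
  have hne : ∃ x, Q 0 x ≠ 0 := by
    by_contra! h
    apply hm1
    apply MvPolynomial.funext
    intro x
    have := h (WithLp.toLp 2 x)
    simp only [Q, hG0] at this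
    simpa using this
  refine ⟨m, Q, N, ?_, ?_, hQ, ?_, hne, ?_⟩
  · by_contra! hlt
    obtain ⟨x, hx⟩ := hne
    have hDf := (mv_deriv f p).hasFDerivAt
    have hz : (∑ i, (MvPolynomial.eval (p : Fin n → ℂ) (MvPolynomial.pderiv i f)) •
        (EuclideanSpace.proj i : EuclideanSpace ℂ (Fin n) →L[ℂ] ℂ)) = 0 := by ext x; simp [hd]
    rw [hz] at hDf
    interval_cases hmm : m
    · have := hQ 0 x
      simp at this
      rw [← this] at hx
      exact hx hfp
    · have hl : HasDerivAt (fun s : ℂ => p + s • x) x 0 := by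
        simpa using ((hasDerivAt_id (0 : ℂ)).smul_const x).const_add p
      have h1 : HasDerivAt (fun s : ℂ => MvPolynomial.eval (p + s • x : EuclideanSpace ℂ (Fin n)) f) 0 0 := by
        have : HasFDerivAt (fun x : EuclideanSpace ℂ (Fin n) => MvPolynomial.eval (x : Fin n → ℂ) f) (0 : EuclideanSpace ℂ (Fin n) →L[ℂ] ℂ) (p + (0 : ℂ) • x) := by simpa using hDf
        exact this.comp_hasDerivAt (0 : ℂ) hl
      have hdq : DifferentiableAt ℂ (fun s => Q s x) 0 := by
        simp only [hQe]
        fun_prop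
      have h2 := (hasDerivAt_id (0 : ℂ)).mul hdq.hasDerivAt
      simp only [hQ, pow_one] at h1
      have h3 := h1.unique h2
      simp at h3
      exact hx h3.symm
  · simp only [hQe]
    refine continuous_finsetSum _ fun d _ => ?_
    exact (continuous_fst.pow _).mul ((mv_cont _).comp continuous_snd)
  · intro c x
    simp only [Q, hG0]
    exact mv_homog (MvPolynomial.homogeneousComponent_isHomogeneous m F) c x
  · intro s x v
    obtain ⟨P, hP, hP2⟩ := mv_line (G s) x v
    refine ⟨P, hP.trans ?_, fun t => ?_⟩
    · refine MvPolynomial.totalDegree_finsetSum_le fun d hd => ?_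
      refine (MvPolynomial.totalDegree_mul _ _).trans ?_
      rw [MvPolynomial.totalDegree_C, zero_add]
      refine (MvPolynomial.homogeneousComponent_isHomogeneous d F).totalDegree_le.trans ?_
      simp at hd; omega
    · rw [← hP2]; rfl

end
end Smith
end

noncomputable section
namespace Smith
open Filter Topology Polynomial nonZeroDivisors

lemma sqf_C {R : Type*} [CommRing R] [IsDomain R] {a : R} (ha : Squarefree a) (ha0 : a ≠ 0) :
    Squarefree (Polynomial.C a) := by
  intro q hq
  have hd : q.natDegree = 0 := by
    obtain ⟨c, hc⟩ := hq
    have hne : q * q * c ≠ 0 := by rw [← hc]; simpa using ha0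
    have h := congrArg Polynomial.natDegree hc
    rw [Polynomial.natDegree_C, Polynomial.natDegree_mul (left_ne_zero_of_mul hne)
      (right_ne_zero_of_mul hne), Polynomial.natDegree_mul (by aesop) (by aesop)] at h
    omega
  rw [Polynomial.eq_C_of_natDegree_eq_zero hd] at hq ⊢
  rw [← Polynomial.C_mul, Polynomial.C_dvd_iff_dvd_coeff] at hq
  have := hq 0
  rw [Polynomial.coeff_C_zero] at this
  exact (ha _ this).map Polynomial.C

lemma sqf_frac {R : Type*} [CommRing R] [IsDomain R] [UniqueFactorizationMonoid R]
    {P : R[X]} (hP : Squarefree P) (hP0 : P ≠ 0) :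
    Squarefree (P.map (algebraMap R (FractionRing R))) := by
  classical
  let : StrongNormalizationMonoid R := UniqueFactorizationMonoid.strongNormalizationMonoid
  let : NormalizedGCDMonoid R := UniqueFactorizationMonoid.toNormalizedGCDMonoid R
  intro q hq
  have hq0 : q ≠ 0 := by
    rintro rfl
    rw [zero_mul, zero_dvd_iff, Polynomial.map_eq_zero_iff (IsFractionRing.injective R _)] at hq
    exact hP0 hq
  set N := IsLocalization.integerNormalization R⁰ q with hN
  obtain ⟨b, hb, hbN⟩ := IsLocalization.integerNormalization_spec R⁰ q
  have hb0 : algebraMap R (FractionRing R) b ≠ 0 := by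
    simpa using nonZeroDivisors.ne_zero hb
  have hqd : (N.primPart.map (algebraMap R (FractionRing R))) ∣ q := by
    have h1 : (N.primPart.map (algebraMap R (FractionRing R))) ∣ N.map (algebraMap R (FractionRing R)) :=
      Polynomial.map_dvd _ N.primPart_dvd
    rw [hN, hbN, ← hN, Algebra.smul_def, Polynomial.algebraMap_apply] at h1
    exact ((Polynomial.isUnit_C.2 (isUnit_iff_ne_zero.2 hb0)).dvd_mul_left).1 h1
  have h2 : N.primPart * N.primPart ∣ P := by
    apply Polynomial.IsPrimitive.dvd_of_fraction_map_dvd_fraction_map (K := FractionRing R)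
    · exact N.isPrimitive_primPart.mul N.isPrimitive_primPart
    · rw [Polynomial.map_mul]
      exact (mul_dvd_mul hqd hqd).trans hq
  exact Polynomial.isUnit_or_eq_zero_of_isUnit_integerNormalization_primPart hq0 (hP _ h2)

lemma sqf_res {R : Type*} [CommRing R] [IsDomain R] [UniqueFactorizationMonoid R] [CharZero R]
    {P : R[X]} (hP : Squarefree P) (hP0 : P ≠ 0) :
    ∃ (A B : R[X]) (c : R), c ≠ 0 ∧ A * P + B * P.derivative = Polynomial.C c := by
  have h := sqf_frac hP hP0
  have : CharZero (FractionRing R) := IsFractionRing.charZero R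
  rw [← PerfectField.separable_iff_squarefree] at h
  obtain ⟨a, b, hab⟩ := h
  obtain ⟨r, hr, hA⟩ := IsLocalization.integerNormalization_spec R⁰ a
  obtain ⟨s, hs, hB⟩ := IsLocalization.integerNormalization_spec R⁰ b
  refine ⟨Polynomial.C s * IsLocalization.integerNormalization R⁰ a,
    Polynomial.C r * IsLocalization.integerNormalization R⁰ b, r * s,
    mul_ne_zero (nonZeroDivisors.ne_zero hr) (nonZeroDivisors.ne_zero hs), ?_⟩
  apply Polynomial.map_injective _ (IsFractionRing.injective R (FractionRing R))
  rw [Polynomial.derivative_map] at hab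
  simp only [Polynomial.map_add, Polynomial.map_mul, Polynomial.map_C, hA, hB, Algebra.smul_def,
    Polynomial.algebraMap_apply, map_mul]
  linear_combination (Polynomial.C (algebraMap R (FractionRing R) r) * Polynomial.C (algebraMap R (FractionRing R) s)) * hab

section
variable {n : ℕ}

def sub (v : Fin n → ℂ) : (MvPolynomial (Fin n) ℂ)[X] →+* (MvPolynomial (Fin n) ℂ)[X] :=
  Polynomial.eval₂RingHom (MvPolynomial.aeval (R := ℂ) (fun i => Polynomial.C (MvPolynomial.X i) +
    Polynomial.C (MvPolynomial.C (v i)) * Polynomial.X) :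
      MvPolynomial (Fin n) ℂ →ₐ[ℂ] (MvPolynomial (Fin n) ℂ)[X]).toRingHom Polynomial.X

lemma sub_sub (u v : Fin n → ℂ) (h : u + v = 0) (q : (MvPolynomial (Fin n) ℂ)[X]) :
    sub u (sub v q) = q := by
  have : (sub u).comp (sub v) = RingHom.id _ := by
    apply Polynomial.ringHom_ext'
    · apply MvPolynomial.ringHom_ext
      · intro r
        simp [sub, Polynomial.algebraMap_apply]
      · intro i
        have hi : u i = - v i := by
          have := congrFun h i
          simp at this
          linear_combination this
        simp [sub, hi, Polynomial.algebraMap_apply]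
        ring
    · simp [sub]
  exact congrArg (fun F => F q) this

lemma sub_eval (v : Fin n → ℂ) (f : MvPolynomial (Fin n) ℂ) (x : Fin n → ℂ) (t : ℂ) :
    ((sub v (Polynomial.C f)).map (MvPolynomial.eval x)).eval t = MvPolynomial.eval (x + t • v) f := by
  induction f using MvPolynomial.induction_on with
  | C a => simp [sub, Polynomial.algebraMap_apply]
  | add a b ha hb => rw [Polynomial.C_add, map_add, Polynomial.map_add, Polynomial.eval_add, ha, hb, map_add]
  | mul_X a j ha =>
    rw [Polynomial.C_mul, map_mul, Polynomial.map_mul, Polynomial.eval_mul, ha, map_mul]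
    simp [sub]
    ring_nf
    simp

lemma sub_sqf (v : Fin n → ℂ) (f : MvPolynomial (Fin n) ℂ) (hf : Squarefree f) (hf0 : f ≠ 0) :
    Squarefree (sub v (Polynomial.C f)) := by
  intro q hq
  have h1 := map_dvd (sub (-v)) hq
  rw [sub_sub _ _ (by simp), map_mul] at h1
  have h2 := (sqf_C hf hf0 _ h1).map (sub v)
  rwa [sub_sub _ _ (by simp)] at h2

lemma mv_simple (f : MvPolynomial (Fin n) ℂ) (hf : Squarefree f) (hf0 : f ≠ 0)
    (p : EuclideanSpace ℂ (Fin n)) (hp : MvPolynomial.eval (p : Fin n → ℂ) f = 0)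
    (ε : ℝ) (hε : 0 < ε) :
    ∃ x ∈ Metric.ball p ε, ∃ v, MvPolynomial.eval (x : Fin n → ℂ) f = 0 ∧ ∃ d, d ≠ 0 ∧
      HasDerivAt (fun t : ℂ => MvPolynomial.eval (x + t • v : EuclideanSpace ℂ (Fin n)) f) d 0 := by
  obtain ⟨y, hy⟩ : ∃ y : EuclideanSpace ℂ (Fin n), MvPolynomial.eval (y : Fin n → ℂ) f ≠ 0 := by
    by_contra! h
    exact hf0 (MvPolynomial.funext fun x => by simpa using h (WithLp.toLp 2 x))
  set v := y - p with hv
  set P := sub (v : Fin n → ℂ) (Polynomial.C f) with hP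
  have hP0 : P ≠ 0 := by
    intro h
    have := sub_eval (v : Fin n → ℂ) f p 1
    rw [← hP, h] at this
    apply hy
    simpa [hv] using this.symm
  obtain ⟨A, B, c, hc, hAB⟩ := sqf_res (sub_sqf (v : Fin n → ℂ) f hf hf0) hP0
  rw [← hP] at hAB
  set ρ := ε / (2 * (‖v‖ + 1)) with hρ
  have hρ0 : 0 < ρ := by positivity
  set D := f.totalDegree
  have hcont : ContinuousAt (fun x : EuclideanSpace ℂ (Fin n) =>
      ‖MvPolynomial.eval ((x + v : EuclideanSpace ℂ (Fin n)) : Fin n → ℂ) f‖ -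
        ‖MvPolynomial.eval (x : Fin n → ℂ) f‖ * (1 + 1 / ρ) ^ D) p := by
    refine ContinuousAt.sub ?_ (ContinuousAt.mul ?_ continuousAt_const)
    · exact ((mv_cont f).comp (continuous_id.add continuous_const)).norm.continuousAt
    · exact (mv_cont f).norm.continuousAt
  have hpos : ∀ᶠ x in 𝓝 p, 0 < ‖MvPolynomial.eval ((x + v : EuclideanSpace ℂ (Fin n)) : Fin n → ℂ) f‖ -
        ‖MvPolynomial.eval (x : Fin n → ℂ) f‖ * (1 + 1 / ρ) ^ D := by
    apply hcont.eventually (lt_mem_nhds _)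
    have : p + v = y := by simp [hv]
    show 0 < ‖MvPolynomial.eval ((p + v : EuclideanSpace ℂ (Fin n)) : Fin n → ℂ) f‖ - _
    rw [this, hp]
    simpa using hy
  have hdense : ∃ᶠ x : EuclideanSpace ℂ (Fin n) in 𝓝 p, MvPolynomial.eval (x : Fin n → ℂ) c ≠ 0 := by
    intro hev
    simp only [not_not] at hev
    have hev2 : ∀ᶠ x : Fin n → ℂ in 𝓝 (p : Fin n → ℂ), MvPolynomial.eval x c = 0 := by
      have h := (PiLp.continuous_toLp 2 (fun _ : Fin n => ℂ)).tendsto (p : Fin n → ℂ)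
      exact h.eventually hev
    obtain ⟨δ, hδ, hb⟩ := Metric.eventually_nhds_iff_ball.1 hev2
    apply hc
    apply MvPolynomial.funext_set (fun i => Metric.ball (p i) δ)
    · intro i
      exact infinite_of_mem_nhds (p i) (Metric.ball_mem_nhds _ hδ)
    · intro x hx
      rw [map_zero]
      apply hb
      rwa [← ball_pi _ hδ] at hx
  obtain ⟨x, hxc, hx1, hx2⟩ := (hdense.and_eventually (hpos.and (Metric.ball_mem_nhds p (half_pos hε)))).exists
  obtain ⟨t, ht, hft⟩ : ∃ t : ℂ, ‖t‖ < ρ ∧ MvPolynomial.eval (x + t • v : EuclideanSpace ℂ (Fin n)) f = 0 := by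
    by_contra! h
    obtain ⟨L, hL, hLe⟩ := mv_line f x v
    have h3 := poly_bound L D hL ρ hρ0 (fun t ht => by rw [← hLe]; exact h t ht) 1
    rw [← hLe, ← hLe] at h3
    simp at h3 hx1
    linarith
  have hder : HasDerivAt (fun s : ℂ => MvPolynomial.eval (x + (t + s) • v : EuclideanSpace ℂ (Fin n)) f)
      ((P.derivative.map (MvPolynomial.eval (x : Fin n → ℂ))).eval t) 0 := by
    have h1 := (P.map (MvPolynomial.eval (x : Fin n → ℂ))).hasDerivAt (t + 0)
    have h2 := h1.comp_const_add t 0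
    rw [Polynomial.derivative_map, add_zero] at h2
    refine h2.congr_of_eventuallyEq (Eventually.of_forall fun s => ?_)
    exact (sub_eval _ _ _ _).symm
  refine ⟨x + t • v, ?_, v, hft,
    (P.derivative.map (MvPolynomial.eval (x : Fin n → ℂ))).eval t, ?_, ?_⟩
  · rw [Metric.mem_ball]
    have h1 : dist (x + t • v) x ≤ ε / 2 := by
      rw [dist_eq_norm, add_sub_cancel_left, norm_smul]
      have : ρ * (‖v‖ + 1) = ε / 2 := by rw [hρ]; field_simp
      nlinarith [norm_nonneg v, norm_nonneg t]
    linarith [dist_triangle (x + t • v) x p]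
  · intro h0
    apply hxc
    have := congrArg (fun W => (W.map (MvPolynomial.eval (x : Fin n → ℂ))).eval t) hAB
    have hs := sub_eval (v : Fin n → ℂ) f x t
    rw [← hP] at hs
    have hft' : MvPolynomial.eval ((x : Fin n → ℂ) + t • (v : Fin n → ℂ)) f = 0 := hft
    simp only [Polynomial.map_add, Polynomial.map_mul, Polynomial.eval_add, Polynomial.eval_mul, h0, hs, hft',
      Polynomial.map_C, Polynomial.eval_C, mul_zero, add_zero] at this
    exact this.symm
  · refine hder.congr_of_eventuallyEq (Eventually.of_forall fun s => ?_)
    simp only [add_smul, add_assoc]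

end
end Smith
end

noncomputable section
namespace Smith

lemma key {n : ℕ} (f g : MvPolynomial (Fin n) ℂ) (hf : Squarefree f) (hf0 : f ≠ 0)
    (U U' : Set (EuclideanSpace ℂ (Fin n)))
    (φ ψ : EuclideanSpace ℂ (Fin n) → EuclideanSpace ℂ (Fin n)) (K : NNReal)
    (hU : IsOpen U) (hU' : IsOpen U') (hmφ : Set.MapsTo φ U U') (hmψ : Set.MapsTo ψ U' U)
    (hl : Set.LeftInvOn ψ φ U) (hr : Set.RightInvOn ψ φ U') (hφ : LipschitzOnWith K φ U)
    (hψ : LipschitzOnWith K ψ U')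
    (hfg : ∀ x ∈ U, MvPolynomial.eval (x : Fin n → ℂ) f = 0 ↔
      MvPolynomial.eval (φ x : Fin n → ℂ) g = 0)
    (p : EuclideanSpace ℂ (Fin n)) (hp : p ∈ U)
    (hfp : MvPolynomial.eval (p : Fin n → ℂ) f = 0)
    (hd : ∀ i, MvPolynomial.eval (p : Fin n → ℂ) (MvPolynomial.pderiv i f) = 0) (i : Fin n) :
    MvPolynomial.eval (φ p : Fin n → ℂ) (MvPolynomial.pderiv i g) = 0 := by
  by_contra hi
  set ℓ := (∑ i, (MvPolynomial.eval (φ p : Fin n → ℂ) (MvPolynomial.pderiv i g)) •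
        (EuclideanSpace.proj i : EuclideanSpace ℂ (Fin n) →L[ℂ] ℂ)) with hℓ
  have hw : ℓ ((MvPolynomial.eval (φ p : Fin n → ℂ) (MvPolynomial.pderiv i g))⁻¹ •
      EuclideanSpace.single i (1 : ℂ)) = 1 := by
    rw [map_smul, hℓ]
    simp [hi]
  obtain ⟨α, β, K', r, h0, h1, h2, h3, h4, h5, h6, h7, h8⟩ :=
    chart ℓ _ hw (fun x => MvPolynomial.eval (x : Fin n → ℂ) f)
      (fun x => MvPolynomial.eval (x : Fin n → ℂ) g) U U' φ ψ K hU hU' hmφ hmψ hl hr hφ hψ hfg p hp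
      ((hfg p hp).1 hfp) (mv_deriv g (φ p))
  obtain ⟨m, Q, D, hm, hQc, hQ, hh, hne, hQD⟩ := mv_blow f hf0 p hfp hd
  exact core ℓ _ hw (fun x => MvPolynomial.eval (x : Fin n → ℂ) f) (mv_cont f) p α β K' r h0 h1 h2
    h3 h4 h5 h6 h7 h8 m hm Q hQc hQ hh hne D hQD (mv_simple f hf hf0 p hfp)

end Smith
end

/-- Theorem: bi-Lipschitz homeomorphisms between the zero sets of nonconstant
square-free homogeneous polynomials send singular points to singular points:
if `φ : U → U'` is a bi-Lipschitz homeomorphism between open neighborhoods of `0`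
with `φ 0 = 0` and `φ (V(f) ∩ U) = V(g) ∩ U'`, then
`φ (Sing V(f) ∩ U) = Sing V(g) ∩ U'`. -/
theorem bilip_sends_singular_to_singular
    (n : ℕ) (f g : MvPolynomial (Fin n) ℂ)
    (hfdeg : 0 < f.totalDegree) (hgdeg : 0 < g.totalDegree)
    (hfsf : Squarefree f) (hgsf : Squarefree g)
    (hfhom : f.IsHomogeneous f.totalDegree) (hghom : g.IsHomogeneous g.totalDegree)
    (U U' : Set (En n)) (φ ψ : En n → En n) (K : NNReal)
    (hUopen : IsOpen U) (hU'open : IsOpen U')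
    (hU0 : (0 : En n) ∈ U) (hU'0 : (0 : En n) ∈ U')
    (hφ0 : φ 0 = 0)
    (hmapsφ : Set.MapsTo φ U U') (hmapsψ : Set.MapsTo ψ U' U)
    (hleft : Set.LeftInvOn ψ φ U) (hright : Set.RightInvOn ψ φ U')
    (hlipφ : LipschitzOnWith K φ U) (hlipψ : LipschitzOnWith K ψ U')
    (himg : φ '' (pV f ∩ U) = pV g ∩ U') :
    φ '' (SingV f ∩ U) = SingV g ∩ U' := by
  have hf0 : f ≠ 0 := by rintro rfl; simp at hfdeg
  have hg0 : g ≠ 0 := by rintro rfl; simp at hgdeg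
  have hfg : ∀ x ∈ U, MvPolynomial.eval (x : Fin n → ℂ) f = 0 ↔
      MvPolynomial.eval (φ x : Fin n → ℂ) g = 0 := by
    intro x hx
    constructor
    · intro h
      have : φ x ∈ pV g ∩ U' := himg ▸ ⟨x, ⟨h, hx⟩, rfl⟩
      exact this.1
    · intro h
      have : φ x ∈ φ '' (pV f ∩ U) := by rw [himg]; exact ⟨h, hmapsφ hx⟩
      obtain ⟨y, ⟨hy, hyU⟩, hyx⟩ := this
      have : y = x := hleft.injOn hyU hx hyx
      rw [← this]; exact hy
  have hgf : ∀ y ∈ U', MvPolynomial.eval (y : Fin n → ℂ) g = 0 ↔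
      MvPolynomial.eval (ψ y : Fin n → ℂ) f = 0 := by
    intro y hy
    rw [hfg _ (hmapsψ hy), hright hy]
  ext y
  constructor
  · rintro ⟨x, ⟨⟨hx, hdx⟩, hxU⟩, rfl⟩
    exact ⟨⟨(hfg x hxU).1 hx, Smith.key f g hfsf hf0 U U' φ ψ K hUopen hU'open hmapsφ hmapsψ hleft
      hright hlipφ hlipψ hfg x hxU hx hdx⟩, hmapsφ hxU⟩
  · rintro ⟨⟨hy, hdy⟩, hyU⟩
    exact ⟨ψ y, ⟨⟨(hgf y hyU).1 hy, Smith.key g f hgsf hg0 U' U ψ φ K hU'open hUopen hmapsψ hmapsφ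
      hright hleft hlipψ hlipφ hgf y hyU hy hdy⟩, hmapsψ hyU⟩, hright hyU⟩
end
end
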